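/- For all b ≥ 2 and ε > 0 there is a constant C = C(b,ε) such that for all x and all D with x^{3/13} ≤ D ≤ x^{8/31−ε}, one has S_b(x,D) ≤ C · x^{7/11} / D^{13/22−ε}. -/

import Mathlib

/-- A positive integer `n` is a base-`b` palindrome if `b ∤ n` and its base-`b`
digit string reads the same forwards and backwards. -/
def IsBPalindrome (b n : ℕ) : Prop := ¬ b ∣ n ∧ (Nat.digits b n).Palindrome

/-- `𝒫*_b(x)`: base-`b` palindromes `n ≤ x` with `gcd(n, b³ - b) = 1`. -/
def PstarSet (b : ℕ) (x : ℝ) : Set ℕ :=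
  {n : ℕ | 0 < n ∧ (n : ℝ) ≤ x ∧ IsBPalindrome b n ∧ Nat.gcd n (b ^ 3 - b) = 1}

/-- `S_b(x, D)`: the number of `n ∈ 𝒫*_b(x)` divisible by `d²` for some
integer `d` with `D ≤ d ≤ 2D`. -/
noncomputable def Scount (b : ℕ) (x D : ℝ) : ℕ :=
  {n : ℕ | n ∈ PstarSet b x ∧ ∃ d : ℕ, D ≤ (d : ℝ) ∧ (d : ℝ) ≤ 2 * D ∧ d ^ 2 ∣ n}.ncard

/-- The additive character `y ↦ exp(2πiy)` of `ℝ`. -/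
noncomputable def expTwoPi (y : ℝ) : ℂ := Complex.exp ((2 * Real.pi * y : ℝ) * Complex.I)

@[simp] lemma norm_expTwoPi (y : ℝ) : ‖expTwoPi y‖ = 1 :=
  Complex.norm_exp_ofReal_mul_I _

lemma expTwoPi_add (x y : ℝ) : expTwoPi (x + y) = expTwoPi x * expTwoPi y := by
  rw [expTwoPi, expTwoPi, expTwoPi, ← Complex.exp_add]
  congr 1
  push_cast
  ring

lemma expTwoPi_neg (x : ℝ) : expTwoPi (-x) = starRingEnd ℂ (expTwoPi x) := by
  rw [expTwoPi, expTwoPi, ← Complex.exp_conj]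
  congr 1
  rw [map_mul, Complex.conj_ofReal, Complex.conj_I]
  push_cast
  ring

lemma expTwoPi_int (n : ℤ) : expTwoPi n = 1 := by
  rw [expTwoPi, Complex.exp_eq_one_iff]
  exact ⟨n, by push_cast; ring⟩

lemma expTwoPi_zero : expTwoPi 0 = 1 := by simpa using expTwoPi_int 0

lemma expTwoPi_sub (x y : ℝ) :
    expTwoPi (x - y) = expTwoPi x * starRingEnd ℂ (expTwoPi y) := by
  rw [sub_eq_add_neg, expTwoPi_add, expTwoPi_neg]

lemma norm_expTwoPi_sub_one_le (y : ℝ) : ‖expTwoPi y - 1‖ ≤ 2 * Real.pi * |y| := by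
  have h := Real.norm_exp_I_mul_ofReal_sub_one_le (x := 2 * Real.pi * y)
  rw [mul_comm Complex.I] at h
  refine h.trans (le_of_eq ?_)
  rw [Real.norm_eq_abs, abs_mul, abs_of_pos Real.two_pi_pos]

lemma norm_expTwoPi_sub_le (x y : ℝ) :
    ‖expTwoPi x - expTwoPi y‖ ≤ 2 * Real.pi * |x - y| := by
  have h : expTwoPi x - expTwoPi y = expTwoPi y * (expTwoPi (x - y) - 1) := by
    rw [mul_sub, ← expTwoPi_add]
    simp
  rw [h, norm_mul, norm_expTwoPi, one_mul]
  exact norm_expTwoPi_sub_one_le _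

lemma le_norm_expTwoPi_sub_one {y : ℝ} (h0 : 0 ≤ y) (h1 : y ≤ 1 / 2) :
    4 * y ≤ ‖expTwoPi y - 1‖ := by
  have h := Complex.norm_exp_I_mul_ofReal_sub_one (2 * Real.pi * y)
  rw [mul_comm Complex.I] at h
  rw [expTwoPi, h, Real.norm_eq_abs]
  have h2 : 2 / Real.pi * (Real.pi * y) ≤ Real.sin (Real.pi * y) :=
    Real.mul_le_sin (by positivity) (by nlinarith [Real.pi_pos])
  have h3 : 2 / Real.pi * (Real.pi * y) = 2 * y := by
    field_simp
  have h4 : 2 * Real.pi * y / 2 = Real.pi * y := by ring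
  rw [h4]
  refine le_trans ?_ (le_abs_self _)
  linarith

lemma sum_sub_mul_eq (E w : ℕ → ℂ) (M : ℕ) :
    ∑ t ∈ Finset.range (M + 1), (E (t + 1) - E t) * w t =
      E (M + 1) * w M - E 0 * w 0 - ∑ t ∈ Finset.range M, E (t + 1) * (w (t + 1) - w t) := by
  induction M with
  | zero => simp; ring
  | succ M ih =>
    rw [Finset.sum_range_succ, ih, Finset.sum_range_succ _ M]
    ring

/-- A form of the Kusmin–Landau inequality. -/
lemma norm_sum_expTwoPi_le_of_antitone {g : ℕ → ℝ} {M : ℕ} {σ : ℝ} (hσ : 0 < σ)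
    (hlow : ∀ t < M, σ ≤ g (t + 1) - g t) (hup : ∀ t < M, g (t + 1) - g t ≤ 1 / 2)
    (hanti : ∀ t, t + 1 < M → g (t + 2) - g (t + 1) ≤ g (t + 1) - g t) :
    ‖∑ t ∈ Finset.range M, expTwoPi (g t)‖ ≤ 1 / σ := by
  rcases M with _ | M
  · simp [hσ.le]
  set φ : ℕ → ℝ := fun t => g (t + 1) - g t with hφ
  set w : ℕ → ℂ := fun t => (expTwoPi (φ t) - 1)⁻¹ with hw
  have hpos : ∀ t < M + 1, 0 < φ t := fun t ht => hσ.trans_le (hlow t ht)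
  have hnorm : ∀ t < M + 1, 4 * φ t ≤ ‖expTwoPi (φ t) - 1‖ := fun t ht =>
    le_norm_expTwoPi_sub_one (hpos t ht).le (hup t ht)
  have hne : ∀ t < M + 1, expTwoPi (φ t) - 1 ≠ 0 := fun t ht => by
    rw [← norm_pos_iff]
    linarith [hnorm t ht, hpos t ht]
  have hterm : ∀ t < M + 1, expTwoPi (g t) = (expTwoPi (g (t + 1)) - expTwoPi (g t)) * w t := by
    intro t ht
    have h1 : expTwoPi (g (t + 1)) = expTwoPi (g t) * expTwoPi (φ t) := by
      rw [← expTwoPi_add]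
      congr 1
      simp [hφ]
    rw [h1, hw]
    field_simp [hne t ht]
  have hwle : ∀ t < M + 1, ‖w t‖ ≤ 1 / (4 * σ) := by
    intro t ht
    rw [hw, norm_inv, ← one_div]
    have := hnorm t ht
    have := hlow t ht
    exact one_div_le_one_div_of_le (by positivity) (by linarith)
  have hdiff : ∀ t ∈ Finset.range M, ‖expTwoPi (g (t + 1)) * (w (t + 1) - w t)‖ ≤
      Real.pi / 8 * (1 / φ (t + 1) - 1 / φ t) := by
    intro t ht
    rw [Finset.mem_range] at ht
    have h1 := hpos t (by omega)
    have h2 := hpos (t + 1) (by omega)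
    have n1 := hnorm t (by omega)
    have n2 := hnorm (t + 1) (by omega)
    have hle : φ (t + 1) ≤ φ t := hanti t (by omega)
    rw [norm_mul, norm_expTwoPi, one_mul, hw]
    have heq : (expTwoPi (φ (t + 1)) - 1)⁻¹ - (expTwoPi (φ t) - 1)⁻¹ =
        (expTwoPi (φ t) - expTwoPi (φ (t + 1))) /
          ((expTwoPi (φ (t + 1)) - 1) * (expTwoPi (φ t) - 1)) := by
      rw [inv_sub_inv (hne _ (by omega)) (hne _ (by omega))]
      ring
    simp only
    rw [heq, norm_div, norm_mul]
    have h3 := norm_expTwoPi_sub_le (φ t) (φ (t + 1))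
    rw [abs_of_nonneg (by linarith)] at h3
    calc _ ≤ 2 * Real.pi * (φ t - φ (t + 1)) / ((4 * φ (t + 1)) * (4 * φ t)) := by
          gcongr
      _ = _ := by
          field_simp
          ring
  calc ‖∑ t ∈ Finset.range (M + 1), expTwoPi (g t)‖
      = ‖∑ t ∈ Finset.range (M + 1), (expTwoPi (g (t + 1)) - expTwoPi (g t)) * w t‖ := by
        rw [Finset.sum_congr rfl fun t ht => hterm t (Finset.mem_range.1 ht)]
    _ ≤ ‖expTwoPi (g (M + 1)) * w M‖ + ‖expTwoPi (g 0) * w 0‖ +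
          ‖∑ t ∈ Finset.range M, expTwoPi (g (t + 1)) * (w (t + 1) - w t)‖ := by
        rw [sum_sub_mul_eq (fun t => expTwoPi (g t)) w M]
        exact (norm_sub_le _ _).trans (add_le_add_left (norm_sub_le _ _) _)
    _ ≤ 1 / (4 * σ) + 1 / (4 * σ) +
          ∑ t ∈ Finset.range M, Real.pi / 8 * (1 / φ (t + 1) - 1 / φ t) := by
        gcongr
        · rw [norm_mul, norm_expTwoPi, one_mul]
          exact hwle M (by omega)
        · rw [norm_mul, norm_expTwoPi, one_mul]
          exact hwle 0 (by omega)
        · exact norm_sum_le_of_le _ hdiff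
    _ ≤ 1 / (4 * σ) + 1 / (4 * σ) + 1 / 2 * (1 / σ) := by
        rw [← Finset.mul_sum, Finset.sum_range_sub (fun t => 1 / φ t)]
        have h1 : 1 / φ M ≤ 1 / σ := one_div_le_one_div_of_le hσ (hlow M (by omega))
        have h2 : 0 < 1 / φ 0 := one_div_pos.2 (hpos 0 (by omega))
        have h3 : 0 < 1 / φ M := one_div_pos.2 (hpos M (by omega))
        have h4 := Real.pi_le_four
        have h5 := Real.pi_pos
        nlinarith
    _ = 1 / σ := by
        field_simp
        ring

/-- The van der Corput inequality. -/
lemma norm_sum_sq_le_vanDerCorput {z : ℕ → ℂ} {n M H : ℕ} (hn : n ≤ M) (hH : 1 ≤ H) (hHM : H ≤ M) :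
    ‖∑ t ∈ Finset.range n, z t‖ ^ 2 ≤ 4 * M / H *
      ∑ a ∈ Finset.range H, ‖∑ t ∈ Finset.range (n - a), z (t + a) * starRingEnd ℂ (z t)‖ := by
  set W : ℕ → ℝ := fun a => ‖∑ t ∈ Finset.range (n - a), z (t + a) * starRingEnd ℂ (z t)‖ with hW
  set u : ℕ → ℕ → ℂ := fun a s => if s ∈ Finset.Ico a (n + a) then z (s - a) else 0 with hu
  have hsum : ∀ a < H, ∑ s ∈ Finset.range (n + H), u a s = ∑ t ∈ Finset.range n, z t := by
    intro a ha
    rw [hu, ← Finset.sum_filter]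
    have : Finset.filter (fun s => s ∈ Finset.Ico a (n + a)) (Finset.range (n + H)) =
        Finset.Ico a (n + a) := by
      ext s
      simp only [Finset.mem_filter, Finset.mem_range, Finset.mem_Ico]
      omega
    rw [this, Finset.sum_Ico_eq_sum_range]
    simp
  have hcorr : ∀ a < H, ∀ a' < H, a ≤ a' →
      ∑ s ∈ Finset.range (n + H), u a s * starRingEnd ℂ (u a' s) =
        ∑ t ∈ Finset.range (n - (a' - a)), z (t + (a' - a)) * starRingEnd ℂ (z t) := by
    intro a ha a' ha' haa
    have h1 : ∀ s, u a s * starRingEnd ℂ (u a' s) =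
        if s ∈ Finset.Ico a' (n + a) then z (s - a) * starRingEnd ℂ (z (s - a')) else 0 := by
      intro s
      simp only [hu, Finset.mem_Ico]
      by_cases h : a' ≤ s ∧ s < n + a
      · rw [if_pos h, if_pos (by omega), if_pos (by omega)]
      · rw [if_neg h]
        by_cases h2 : a ≤ s ∧ s < n + a
        · rw [if_neg (c := a' ≤ s ∧ s < n + a') (by omega)]
          simp
        · rw [if_neg h2]
          simp
    simp_rw [h1]
    rw [← Finset.sum_filter]
    have : Finset.filter (fun s => s ∈ Finset.Ico a' (n + a)) (Finset.range (n + H)) =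
        Finset.Ico a' (n + a) := by
      ext s
      simp only [Finset.mem_filter, Finset.mem_range, Finset.mem_Ico]
      omega
    rw [this, Finset.sum_Ico_eq_sum_range]
    refine Finset.sum_congr (by congr 1; omega) fun t _ => ?_
    congr 3 <;> omega
  have hcorr' : ∀ a < H, ∀ a' < H,
      ‖∑ s ∈ Finset.range (n + H), u a s * starRingEnd ℂ (u a' s)‖ ≤
        (if a ≤ a' then W (a' - a) else 0) + (if a' ≤ a then W (a - a') else 0) := by
    intro a ha a' ha'
    have hW0 : ∀ a, 0 ≤ W a := fun a => norm_nonneg _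
    rcases le_total a a' with h | h
    · rw [hcorr a ha a' ha' h, if_pos h]
      split_ifs <;> linarith [hW0 (a - a')]
    · have : ∑ s ∈ Finset.range (n + H), u a s * starRingEnd ℂ (u a' s) =
          starRingEnd ℂ (∑ s ∈ Finset.range (n + H), u a' s * starRingEnd ℂ (u a s)) := by
        rw [map_sum]
        refine Finset.sum_congr rfl fun s _ => ?_
        rw [map_mul, Complex.conj_conj, mul_comm]
      rw [this, RCLike.norm_conj, hcorr a' ha' a ha h, if_pos h]
      split_ifs <;> linarith [hW0 (a' - a)]
  have hrow : ∀ a < H, ∑ a' ∈ Finset.range H, ((if a ≤ a' then W (a' - a) else 0) +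
      (if a' ≤ a then W (a - a') else 0)) ≤ 2 * ∑ a ∈ Finset.range H, W a := by
    intro a ha
    rw [Finset.sum_add_distrib, two_mul]
    have hW0 : ∀ a, 0 ≤ W a := fun a => norm_nonneg _
    refine add_le_add ?_ ?_
    · rw [← Finset.sum_filter]
      rw [← Finset.sum_image (f := W) (g := fun a' => a' - a)]
      · refine Finset.sum_le_sum_of_subset_of_nonneg ?_ fun _ _ _ => hW0 _
        intro s hs
        simp only [Finset.mem_image, Finset.mem_filter, Finset.mem_range] at hs ⊢
        omega
      · intro s hs t ht hst
        simp only [Finset.coe_filter, Finset.mem_range, Set.mem_ofPred_eq] at hs ht hst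
        omega
    · rw [← Finset.sum_filter]
      rw [← Finset.sum_image (f := W) (g := fun a' => a - a')]
      · refine Finset.sum_le_sum_of_subset_of_nonneg ?_ fun _ _ _ => hW0 _
        intro s hs
        simp only [Finset.mem_image, Finset.mem_filter, Finset.mem_range] at hs ⊢
        omega
      · intro s hs t ht hst
        simp only [Finset.coe_filter, Finset.mem_range, Set.mem_ofPred_eq] at hs ht hst
        omega
  have hHpos : (0 : ℝ) < H := by exact_mod_cast hH
  have htot : (H : ℂ) * ∑ t ∈ Finset.range n, z t =
      ∑ s ∈ Finset.range (n + H), ∑ a ∈ Finset.range H, u a s := by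
    rw [Finset.sum_comm, Finset.sum_congr rfl fun a ha => hsum a (Finset.mem_range.1 ha)]
    simp
  have hsq : ∀ s, ((‖∑ a ∈ Finset.range H, u a s‖ ^ 2 : ℝ) : ℂ) =
      ∑ a ∈ Finset.range H, ∑ a' ∈ Finset.range H, u a s * starRingEnd ℂ (u a' s) := by
    intro s
    rw [Complex.ofReal_pow, ← Complex.mul_conj', map_sum, Finset.sum_mul_sum]
  have henergy : ∑ s ∈ Finset.range (n + H), ‖∑ a ∈ Finset.range H, u a s‖ ^ 2 ≤
      H * (2 * ∑ a ∈ Finset.range H, W a) := by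
    have h1 : ((∑ s ∈ Finset.range (n + H), ‖∑ a ∈ Finset.range H, u a s‖ ^ 2 : ℝ) : ℂ) =
        ∑ a ∈ Finset.range H, ∑ a' ∈ Finset.range H,
          ∑ s ∈ Finset.range (n + H), u a s * starRingEnd ℂ (u a' s) := by
      rw [Complex.ofReal_sum, Finset.sum_congr rfl fun s _ => hsq s, Finset.sum_comm]
      exact Finset.sum_congr rfl fun a _ => Finset.sum_comm
    calc _ ≤ ‖((∑ s ∈ Finset.range (n + H), ‖∑ a ∈ Finset.range H, u a s‖ ^ 2 : ℝ) : ℂ)‖ := by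
          rw [Complex.norm_real]
          exact le_abs_self _
      _ ≤ ∑ a ∈ Finset.range H, 2 * ∑ a ∈ Finset.range H, W a := by
          rw [h1]
          refine norm_sum_le_of_le _ fun a ha => ?_
          refine le_trans (norm_sum_le_of_le _ fun a' ha' => ?_) (hrow a (Finset.mem_range.1 ha))
          exact hcorr' a (Finset.mem_range.1 ha) a' (Finset.mem_range.1 ha')
      _ = _ := by simp
  have hCS : ((H : ℝ) * ‖∑ t ∈ Finset.range n, z t‖) ^ 2 ≤
      (n + H) * ∑ s ∈ Finset.range (n + H), ‖∑ a ∈ Finset.range H, u a s‖ ^ 2 := by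
    have h1 : (H : ℝ) * ‖∑ t ∈ Finset.range n, z t‖ ≤
        ∑ s ∈ Finset.range (n + H), ‖∑ a ∈ Finset.range H, u a s‖ := by
      have := norm_sum_le (Finset.range (n + H)) (fun s => ∑ a ∈ Finset.range H, u a s)
      rwa [← htot, norm_mul, Complex.norm_natCast] at this
    calc _ ≤ (∑ s ∈ Finset.range (n + H), ‖∑ a ∈ Finset.range H, u a s‖) ^ 2 := by gcongr
      _ ≤ _ := by
        have := sq_sum_le_card_mul_sum_sq (s := Finset.range (n + H))
          (f := fun s => ‖∑ a ∈ Finset.range H, u a s‖)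
        simpa using this
  have hWs : 0 ≤ ∑ a ∈ Finset.range H, W a := Finset.sum_nonneg fun _ _ => norm_nonneg _
  have hnM : (n : ℝ) + H ≤ 2 * M := by
    have h1 : (n : ℝ) ≤ M := by exact_mod_cast hn
    have h2 : (H : ℝ) ≤ M := by exact_mod_cast hHM
    linarith
  have hfin : (H : ℝ) ^ 2 * ‖∑ t ∈ Finset.range n, z t‖ ^ 2 ≤
      (2 * M) * (H * (2 * ∑ a ∈ Finset.range H, W a)) := by
    rw [← mul_pow]
    refine hCS.trans (mul_le_mul hnM henergy (Finset.sum_nonneg fun _ _ => by positivity)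
      (by positivity))
  rw [div_mul_eq_mul_div, le_div_iff₀ hHpos]
  refine le_of_mul_le_mul_left ?_ hHpos
  linarith

lemma sum_Ico_one_div_le {H M : ℕ} (hHM : H ≤ M) :
    ∑ a ∈ Finset.Ico 1 H, 1 / (a : ℝ) ≤ 1 + Real.log M := by
  have h1 := harmonic_le_one_add_log M
  have h2 : ((harmonic M : ℚ) : ℝ) = ∑ a ∈ Finset.Icc 1 M, 1 / (a : ℝ) := by
    rw [harmonic_eq_sum_Icc]
    push_cast
    simp
  rw [h2] at h1
  refine le_trans (Finset.sum_le_sum_of_subset_of_nonneg ?_ fun _ _ _ => by positivity) h1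
  intro a ha
  simp only [Finset.mem_Ico, Finset.mem_Icc] at ha ⊢
  omega

lemma norm_sum_expTwoPi_sq_le {f : ℕ → ℝ} {n M H : ℕ} (hn : n ≤ M) (hH : 1 ≤ H) (hHM : H ≤ M) :
    ‖∑ t ∈ Finset.range n, expTwoPi (f t)‖ ^ 2 ≤ 4 * M / H *
      (M + ∑ a ∈ Finset.Ico 1 H,
        ‖∑ t ∈ Finset.range (n - a), expTwoPi (f (t + a) - f t)‖) := by
  refine (norm_sum_sq_le_vanDerCorput hn hH hHM).trans ?_
  gcongr
  rw [Finset.range_eq_Ico, Finset.sum_eq_sum_Ico_succ_bot (by omega)]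
  refine add_le_add ?_ (le_of_eq ?_)
  · refine (norm_sum_le _ _).trans ?_
    simp only [norm_mul, RCLike.norm_conj, norm_expTwoPi]
    simpa using hn
  · refine Finset.sum_congr rfl fun a _ => ?_
    simp only [expTwoPi_sub]

/-- A third-difference test: two van der Corput steps followed by the Kusmin–Landau inequality. -/
lemma norm_sum_expTwoPi_pow_four_le {f : ℕ → ℝ} {M H₁ H₂ : ℕ} {μ : ℝ} (hμ : 0 < μ)
    (h1 : 1 ≤ H₁) (h1M : H₁ ≤ M) (h2 : 1 ≤ H₂) (h2M : H₂ ≤ M)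
    (hlow : ∀ a a' t : ℕ, 1 ≤ a → a < H₁ → 1 ≤ a' → a' < H₂ → t + a + a' < M →
      a * a' * μ ≤ ((f (t + 1 + a' + a) - f (t + 1 + a')) - (f (t + 1 + a) - f (t + 1))) -
        ((f (t + a' + a) - f (t + a')) - (f (t + a) - f t)))
    (hup : ∀ a a' t : ℕ, 1 ≤ a → a < H₁ → 1 ≤ a' → a' < H₂ → t + a + a' < M →
      ((f (t + 1 + a' + a) - f (t + 1 + a')) - (f (t + 1 + a) - f (t + 1))) -
        ((f (t + a' + a) - f (t + a')) - (f (t + a) - f t)) ≤ 1 / 2)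
    (hanti : ∀ a a' t : ℕ, 1 ≤ a → a < H₁ → 1 ≤ a' → a' < H₂ → t + 1 + a + a' < M →
      ((f (t + 2 + a' + a) - f (t + 2 + a')) - (f (t + 2 + a) - f (t + 2))) -
        ((f (t + 1 + a' + a) - f (t + 1 + a')) - (f (t + 1 + a) - f (t + 1))) ≤
      ((f (t + 1 + a' + a) - f (t + 1 + a')) - (f (t + 1 + a) - f (t + 1))) -
        ((f (t + a' + a) - f (t + a')) - (f (t + a) - f t))) :
    ‖∑ t ∈ Finset.range M, expTwoPi (f t)‖ ^ 4 ≤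
      32 * M ^ 4 / H₁ ^ 2 + 128 * M ^ 4 / H₂ +
        128 * M ^ 3 * (1 + Real.log M) ^ 2 / (H₁ * H₂ * μ) := by
  set ℓ := 1 + Real.log M with hℓ
  have hM : 1 ≤ M := h1.trans h1M
  have hℓ1 : 1 ≤ ℓ := by
    have : 0 ≤ Real.log M := Real.log_natCast_nonneg M
    linarith
  have hH1 : (0 : ℝ) < H₁ := by exact_mod_cast h1
  have hH2 : (0 : ℝ) < H₂ := by exact_mod_cast h2
  have hMpos : (0 : ℝ) < M := by exact_mod_cast hM
  set S : ℕ → ℝ := fun a => ‖∑ t ∈ Finset.range (M - a), expTwoPi (f (t + a) - f t)‖ with hS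
  have hSa : ∀ a ∈ Finset.Ico 1 H₁, S a ^ 2 ≤ 4 * M / H₂ * (M + ℓ / μ * (1 / a)) := by
    intro a ha
    rw [Finset.mem_Ico] at ha
    have hapos : (0 : ℝ) < a := by exact_mod_cast ha.1
    refine (norm_sum_expTwoPi_sq_le (f := fun t => f (t + a) - f t)
      (Nat.sub_le M a) h2 h2M).trans ?_
    gcongr
    calc _ ≤ ∑ a' ∈ Finset.Ico 1 H₂, 1 / (a * μ) * (1 / (a' : ℝ)) := by
          refine Finset.sum_le_sum fun a' ha' => ?_
          rw [Finset.mem_Ico] at ha'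
          have hapos' : (0 : ℝ) < a' := by exact_mod_cast ha'.1
          refine (norm_sum_expTwoPi_le_of_antitone (σ := a * a' * μ) (by positivity)
            ?_ ?_ ?_).trans (le_of_eq ?_)
          · intro t ht
            exact hlow a a' t ha.1 ha.2 ha'.1 ha'.2 (by omega)
          · intro t ht
            exact hup a a' t ha.1 ha.2 ha'.1 ha'.2 (by omega)
          · intro t ht
            exact hanti a a' t ha.1 ha.2 ha'.1 ha'.2 (by omega)
          · field_simp
      _ ≤ 1 / (a * μ) * ℓ := by
          rw [← Finset.mul_sum]
          gcongr
          exact sum_Ico_one_div_le h2M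
      _ = ℓ / μ * (1 / a) := by field_simp
  have hSsq : (∑ a ∈ Finset.Ico 1 H₁, S a) ^ 2 ≤
      H₁ * (4 * M / H₂ * (H₁ * M + ℓ ^ 2 / μ)) := by
    have hcs := sq_sum_le_card_mul_sum_sq (s := Finset.Ico 1 H₁) (f := S)
    have hcard : ((Finset.Ico 1 H₁).card : ℝ) ≤ H₁ := by
      rw [Nat.card_Ico]
      exact_mod_cast Nat.sub_le _ _
    refine hcs.trans (mul_le_mul hcard ?_ (Finset.sum_nonneg fun _ _ => sq_nonneg _) hH1.le)
    refine (Finset.sum_le_sum hSa).trans ?_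
    rw [← Finset.mul_sum, Finset.sum_add_distrib, ← Finset.mul_sum]
    gcongr
    · rw [Finset.sum_const, nsmul_eq_mul]
      gcongr
    · calc _ ≤ ℓ / μ * ℓ := by
            gcongr
            exact sum_Ico_one_div_le h1M
        _ = _ := by ring
  have hfirst := norm_sum_expTwoPi_sq_le (f := f) (le_refl M) h1 h1M
  calc ‖∑ t ∈ Finset.range M, expTwoPi (f t)‖ ^ 4
      = (‖∑ t ∈ Finset.range M, expTwoPi (f t)‖ ^ 2) ^ 2 := by ring
    _ ≤ (4 * M / H₁ * (M + ∑ a ∈ Finset.Ico 1 H₁, S a)) ^ 2 := by gcongr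
    _ = 16 * M ^ 2 / H₁ ^ 2 * (M + ∑ a ∈ Finset.Ico 1 H₁, S a) ^ 2 := by
        field_simp
        ring
    _ ≤ 16 * M ^ 2 / H₁ ^ 2 * (2 * (M ^ 2 + H₁ * (4 * M / H₂ * (H₁ * M + ℓ ^ 2 / μ)))) := by
        gcongr
        nlinarith [sq_nonneg ((M : ℝ) - ∑ a ∈ Finset.Ico 1 H₁, S a)]
    _ = _ := by
        field_simp
        ring

lemma half_le_norm_sum_expTwoPi {y : ℝ} {n : ℤ} {K : ℕ} (hy : |y - n| ≤ 1 / (6 * K)) :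
    (K : ℝ) / 2 ≤ ‖∑ k ∈ Finset.range K, expTwoPi (k * y)‖ := by
  refine le_trans ?_ (Complex.re_le_norm _)
  rw [Complex.re_sum]
  have hterm : ∀ k ∈ Finset.range K, (1 / 2 : ℝ) ≤ (expTwoPi (k * y)).re := by
    intro k hk
    rw [Finset.mem_range] at hk
    have h1 : (k : ℝ) * y = k * (y - n) + ((k * n : ℤ) : ℝ) := by
      push_cast
      ring
    rw [h1, expTwoPi_add, expTwoPi_int, mul_one, expTwoPi, Complex.exp_ofReal_mul_I_re,
      ← Real.cos_abs, ← Real.cos_pi_div_three]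
    have hKpos : (0 : ℝ) < K := by
      exact_mod_cast (show 0 < K by omega)
    have hkK : (k : ℝ) ≤ K := by exact_mod_cast hk.le
    have h2 : |2 * Real.pi * (k * (y - n))| ≤ Real.pi / 3 := by
      rw [abs_mul, abs_of_pos Real.two_pi_pos, abs_mul, Nat.abs_cast]
      calc 2 * Real.pi * (k * |y - n|) ≤ 2 * Real.pi * (K * (1 / (6 * K))) := by gcongr
        _ = Real.pi / 3 := by
          field_simp
          ring
    exact Real.cos_le_cos_of_nonneg_of_le_pi (abs_nonneg _) (by linarith [Real.pi_pos]) h2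
  have := Finset.sum_le_sum hterm
  simp only [Finset.sum_const, Finset.card_range, nsmul_eq_mul] at this
  linarith

/-- The number of `t` for which `g t` is close to an integer, bounded by exponential sums. -/
lemma card_near_int_le {g : ℕ → ℝ} {M K : ℕ} {S : ℝ} (hK : 1 ≤ K) (hS : 0 ≤ S)
    (G : Finset ℕ) (hGM : G ⊆ Finset.range M)
    (hG : ∀ t ∈ G, ∃ n : ℤ, |g t - n| ≤ 1 / (6 * K))
    (hsum : ∀ h : ℕ, 1 ≤ h → h < K → ‖∑ t ∈ Finset.range M, expTwoPi (h * g t)‖ ≤ S) :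
    (G.card : ℝ) ≤ 4 * M / K + 4 * S := by
  have hKpos : (0 : ℝ) < K := by exact_mod_cast hK
  have hlow : (G.card : ℝ) * (K / 2) ^ 2 ≤
      ∑ t ∈ Finset.range M, ‖∑ k ∈ Finset.range K, expTwoPi (k * g t)‖ ^ 2 := by
    rw [← nsmul_eq_mul]
    refine (Finset.card_nsmul_le_sum G _ _ fun t ht => ?_).trans
      (Finset.sum_le_sum_of_subset_of_nonneg hGM fun _ _ _ => sq_nonneg _)
    obtain ⟨n, hn⟩ := hG t ht
    exact pow_le_pow_left₀ (by positivity) (half_le_norm_sum_expTwoPi hn) 2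
  have hsq : ∀ t, ((‖∑ k ∈ Finset.range K, expTwoPi (k * g t)‖ ^ 2 : ℝ) : ℂ) =
      ∑ k ∈ Finset.range K, ∑ k' ∈ Finset.range K, expTwoPi (k * g t - k' * g t) := by
    intro t
    rw [Complex.ofReal_pow, ← Complex.mul_conj', map_sum, Finset.sum_mul_sum]
    simp only [expTwoPi_sub]
  have hpair : ∀ k ∈ Finset.range K, ∀ k' ∈ Finset.range K,
      ‖∑ t ∈ Finset.range M, expTwoPi (k * g t - k' * g t)‖ ≤
        (if k = k' then (M : ℝ) else 0) + S := by
    have key : ∀ k k' : ℕ, k < K → k' < k →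
        ‖∑ t ∈ Finset.range M, expTwoPi (k * g t - k' * g t)‖ ≤ S := by
      intro k k' hk hkk
      have := hsum (k - k') (by omega) (by omega)
      rw [Nat.cast_sub hkk.le] at this
      simpa only [sub_mul] using this
    intro k hk k' hk'
    rw [Finset.mem_range] at hk hk'
    rcases lt_trichotomy k k' with h | h | h
    · rw [if_neg h.ne, zero_add]
      have h3 := key k' k hk' h
      rw [← RCLike.norm_conj, map_sum] at h3
      simpa only [← expTwoPi_neg, neg_sub] using h3
    · subst h
      simp only [sub_self, expTwoPi_zero, if_true]
      simpa using hS
    · rw [if_neg h.ne', zero_add]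
      exact key k k' hk h
  have hup : ∑ t ∈ Finset.range M, ‖∑ k ∈ Finset.range K, expTwoPi (k * g t)‖ ^ 2 ≤
      K * (M + K * S) := by
    have h1 : ((∑ t ∈ Finset.range M, ‖∑ k ∈ Finset.range K, expTwoPi (k * g t)‖ ^ 2 : ℝ) : ℂ) =
        ∑ k ∈ Finset.range K, ∑ k' ∈ Finset.range K,
          ∑ t ∈ Finset.range M, expTwoPi (k * g t - k' * g t) := by
      rw [Complex.ofReal_sum, Finset.sum_congr rfl fun s _ => hsq s, Finset.sum_comm]
      exact Finset.sum_congr rfl fun a _ => Finset.sum_comm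
    calc _ ≤ ‖((∑ t ∈ Finset.range M,
            ‖∑ k ∈ Finset.range K, expTwoPi (k * g t)‖ ^ 2 : ℝ) : ℂ)‖ := by
          rw [Complex.norm_real]
          exact le_abs_self _
      _ ≤ ∑ k ∈ Finset.range K, ∑ k' ∈ Finset.range K, ((if k = k' then (M : ℝ) else 0) + S) := by
          rw [h1]
          exact norm_sum_le_of_le _ fun k hk => norm_sum_le_of_le _ fun k' hk' => hpair k hk k' hk'
      _ ≤ ∑ k ∈ Finset.range K, (M + K * S) := by
          refine Finset.sum_le_sum fun k hk => ?_
          rw [Finset.sum_add_distrib, Finset.sum_ite_eq, if_pos hk]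
          simp
      _ = _ := by
        simp
        ring
  have h := hlow.trans hup
  have h2 : (G.card : ℝ) ≤ 4 * (K * (M + K * S)) / K ^ 2 := by
    rw [le_div_iff₀ (by positivity)]
    linarith
  refine h2.trans (le_of_eq ?_)
  field_simp

lemma exists_sub_eq_mul_deriv {F F' : ℝ → ℝ} (hF : ∀ y, 0 < y → HasDerivAt F (F' y) y)
    {y p : ℝ} (hy : 0 < y) (hp : 0 < p) :
    ∃ ξ, y ≤ ξ ∧ ξ ≤ y + p ∧ F (y + p) - F y = p * F' ξ := by
  obtain ⟨ξ, hξ, h⟩ := exists_hasDerivAt_eq_slope F F' (show y < y + p by linarith)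
    (fun z hz => (hF z (hy.trans_le hz.1)).continuousAt.continuousWithinAt)
    (fun z hz => hF z (hy.trans hz.1))
  refine ⟨ξ, hξ.1.le, hξ.2.le, ?_⟩
  rw [h, add_sub_cancel_left, mul_div_cancel₀ _ hp.ne']

/-- The mean value theorem for third-order mixed differences. -/
lemma exists_third_diff_eq {F F₁ F₂ F₃ : ℝ → ℝ} (h1 : ∀ y, 0 < y → HasDerivAt F (F₁ y) y)
    (h2 : ∀ y, 0 < y → HasDerivAt F₁ (F₂ y) y) (h3 : ∀ y, 0 < y → HasDerivAt F₂ (F₃ y) y)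
    {y p q r : ℝ} (hy : 0 < y) (hp : 0 < p) (hq : 0 < q) (hr : 0 < r) :
    ∃ ξ, y ≤ ξ ∧ ξ ≤ y + p + q + r ∧
      ((F (y + r + q + p) - F (y + r + q)) - (F (y + r + p) - F (y + r))) -
        ((F (y + q + p) - F (y + q)) - (F (y + p) - F y)) = p * q * r * F₃ ξ := by
  have shift : ∀ {G G' : ℝ → ℝ} (s : ℝ), 0 < s → (∀ y, 0 < y → HasDerivAt G (G' y) y) →
      ∀ y, 0 < y → HasDerivAt (fun y => G (y + s) - G y) (G' (y + s) - G' y) y := by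
    intro G G' s hs hG y hy
    exact ((hG (y + s) (by linarith)).comp_add_const y s).sub (hG y hy)
  obtain ⟨ξ₁, hξ₁, hξ₁', e1⟩ := exists_sub_eq_mul_deriv (shift q hq (shift p hp h1)) hy hr
  obtain ⟨ξ₂, hξ₂, hξ₂', e2⟩ := exists_sub_eq_mul_deriv (shift p hp h2) (hy.trans_le hξ₁) hq
  obtain ⟨ξ₃, hξ₃, hξ₃', e3⟩ :=
    exists_sub_eq_mul_deriv h3 ((hy.trans_le hξ₁).trans_le hξ₂) hp
  refine ⟨ξ₃, by linarith, by linarith, ?_⟩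
  rw [e1, e2, e3]
  ring

lemma hasDerivAt_const_mul_inv_pow (c : ℝ) (n : ℕ) {y : ℝ} (hy : 0 < y) :
    HasDerivAt (fun y : ℝ => c * (y ^ (n + 1))⁻¹) (-(c * (n + 1)) * (y ^ (n + 2))⁻¹) y := by
  have h := ((hasDerivAt_pow (n + 1) y).fun_inv (pow_ne_zero _ hy.ne')).const_mul c
  refine h.congr_deriv ?_
  push_cast
  field_simp
  ring

lemma hasDerivAt_neg_inv_sq (y : ℝ) (hy : 0 < y) :
    HasDerivAt (fun y : ℝ => -(y ^ 2)⁻¹) (2 * (y ^ 3)⁻¹) y := by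
  have := hasDerivAt_const_mul_inv_pow (-1) 1 hy
  norm_num at this
  exact this

lemma hasDerivAt_two_mul_inv_cube (y : ℝ) (hy : 0 < y) :
    HasDerivAt (fun y : ℝ => 2 * (y ^ 3)⁻¹) (-(6 * (y ^ 4)⁻¹)) y := by
  have := hasDerivAt_const_mul_inv_pow 2 2 hy
  norm_num at this
  exact this

lemma hasDerivAt_neg_six_mul_inv_pow_four (y : ℝ) (hy : 0 < y) :
    HasDerivAt (fun y : ℝ => -(6 * (y ^ 4)⁻¹)) (24 * (y ^ 5)⁻¹) y := by
  have := hasDerivAt_const_mul_inv_pow (-6) 3 hy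
  norm_num at this
  exact this

lemma exists_third_diff_neg_inv_sq {y p q r : ℝ} (hy : 0 < y) (hp : 0 < p) (hq : 0 < q)
    (hr : 0 < r) :
    ∃ ξ, y ≤ ξ ∧ ξ ≤ y + p + q + r ∧
      ((-((y + r + q + p) ^ 2)⁻¹ - -((y + r + q) ^ 2)⁻¹) -
        (-((y + r + p) ^ 2)⁻¹ - -((y + r) ^ 2)⁻¹)) -
        ((-((y + q + p) ^ 2)⁻¹ - -((y + q) ^ 2)⁻¹) - (-((y + p) ^ 2)⁻¹ - -(y ^ 2)⁻¹)) =
      p * q * r * (24 * (ξ ^ 5)⁻¹) := by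
  exact exists_third_diff_eq hasDerivAt_neg_inv_sq hasDerivAt_two_mul_inv_cube
    hasDerivAt_neg_six_mul_inv_pow_four hy hp hq hr

/-- Third-order mixed differences of `-1/y²` decrease. -/
lemma third_diff_neg_inv_sq_anti {y p q r s : ℝ} (hy : 0 < y) (hp : 0 < p) (hq : 0 < q)
    (hr : 0 < r) (hs : 0 < s) :
      ((-((y + s + r + q + p) ^ 2)⁻¹ - -((y + s + r + q) ^ 2)⁻¹) -
        (-((y + s + r + p) ^ 2)⁻¹ - -((y + s + r) ^ 2)⁻¹)) -
        ((-((y + s + q + p) ^ 2)⁻¹ - -((y + s + q) ^ 2)⁻¹) -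
          (-((y + s + p) ^ 2)⁻¹ - -((y + s) ^ 2)⁻¹)) ≤
      ((-((y + r + q + p) ^ 2)⁻¹ - -((y + r + q) ^ 2)⁻¹) -
        (-((y + r + p) ^ 2)⁻¹ - -((y + r) ^ 2)⁻¹)) -
        ((-((y + q + p) ^ 2)⁻¹ - -((y + q) ^ 2)⁻¹) - (-((y + p) ^ 2)⁻¹ - -(y ^ 2)⁻¹)) := by
  have shift : ∀ {G G' : ℝ → ℝ}, (∀ y, 0 < y → HasDerivAt G (G' y) y) →
      ∀ y, 0 < y → HasDerivAt (fun y => G (y + s) - G y) (G' (y + s) - G' y) y := by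
    intro G G' hG y hy
    exact ((hG (y + s) (by linarith)).comp_add_const y s).sub (hG y hy)
  obtain ⟨ξ, hξ, -, e⟩ := exists_third_diff_eq (shift hasDerivAt_neg_inv_sq)
    (shift hasDerivAt_two_mul_inv_cube) (shift hasDerivAt_neg_six_mul_inv_pow_four) hy hp hq hr
  have hneg : ((ξ + s) ^ 5)⁻¹ ≤ (ξ ^ 5)⁻¹ := by
    have : 0 < ξ := hy.trans_le hξ
    gcongr
    linarith
  have hprod : p * q * r * (24 * ((ξ + s) ^ 5)⁻¹ - 24 * (ξ ^ 5)⁻¹) ≤ 0 :=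
    mul_nonpos_of_nonneg_of_nonpos (by positivity) (by linarith)
  rw [← e] at hprod
  have c1 : y + r + q + p + s = y + s + r + q + p := by ring
  have c2 : y + r + q + s = y + s + r + q := by ring
  have c3 : y + r + p + s = y + s + r + p := by ring
  have c4 : y + r + s = y + s + r := by ring
  have c5 : y + q + p + s = y + s + q + p := by ring
  have c6 : y + q + s = y + s + q := by ring
  have c7 : y + p + s = y + s + p := by ring
  simp only [c1, c2, c3, c4, c5, c6, c7] at hprod
  linarith

/-- Mixed third differences along an arithmetic progression ignore quadratic polynomials. -/
lemma third_diff_add_quadratic (F : ℝ → ℝ) (κ d B α β γ : ℝ) {f : ℕ → ℝ}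
    (hf : ∀ t, f t = κ * F (d + B * t) + (α + β * t + γ * t ^ 2)) (a a' t : ℕ) :
    ((f (t + 1 + a' + a) - f (t + 1 + a')) - (f (t + 1 + a) - f (t + 1))) -
        ((f (t + a' + a) - f (t + a')) - (f (t + a) - f t)) =
      κ * (((F (d + B * t + B + B * a' + B * a) - F (d + B * t + B + B * a')) -
          (F (d + B * t + B + B * a) - F (d + B * t + B))) -
        ((F (d + B * t + B * a' + B * a) - F (d + B * t + B * a')) -
          (F (d + B * t + B * a) - F (d + B * t)))) := by
  have c1 : d + B * ((t + 1 + a' + a : ℕ) : ℝ) = d + B * t + B + B * a' + B * a := by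
    push_cast; ring
  have c2 : d + B * ((t + 1 + a' : ℕ) : ℝ) = d + B * t + B + B * a' := by push_cast; ring
  have c3 : d + B * ((t + 1 + a : ℕ) : ℝ) = d + B * t + B + B * a := by push_cast; ring
  have c4 : d + B * ((t + 1 : ℕ) : ℝ) = d + B * t + B := by push_cast; ring
  have c5 : d + B * ((t + a' + a : ℕ) : ℝ) = d + B * t + B * a' + B * a := by push_cast; ring
  have c6 : d + B * ((t + a' : ℕ) : ℝ) = d + B * t + B * a' := by push_cast; ring
  have c7 : d + B * ((t + a : ℕ) : ℝ) = d + B * t + B * a := by push_cast; ring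
  simp only [hf, c1, c2, c3, c4, c5, c6, c7]
  push_cast
  ring

/-- Exponential sums with phase an inverse square plus a quadratic polynomial. -/
lemma norm_sum_inv_sq_phase_pow_four_le {κ d B D α β γ : ℝ} {f : ℕ → ℝ} {M H₁ H₂ : ℕ}
    (hf : ∀ t, f t = κ * -((d + B * t) ^ 2)⁻¹ + (α + β * t + γ * t ^ 2))
    (hκ : 0 < κ) (hB : 0 < B) (hD : 0 < D) (hd : D ≤ d) (hdM : d + B * M ≤ 4 * D)
    (h1 : 1 ≤ H₁) (h1M : H₁ ≤ M) (h2 : 1 ≤ H₂) (h2M : H₂ ≤ M)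
    (hsmall : 24 * κ * B ^ 3 * (H₁ * H₂) / D ^ 5 ≤ 1 / 2) :
    ‖∑ t ∈ Finset.range M, expTwoPi (f t)‖ ^ 4 ≤
      32 * M ^ 4 / H₁ ^ 2 + 128 * M ^ 4 / H₂ +
        128 * M ^ 3 * (1 + Real.log M) ^ 2 / (H₁ * H₂ * (24 * κ * B ^ 3 / (4 * D) ^ 5)) := by
  have hdiff := third_diff_add_quadratic (fun y => -(y ^ 2)⁻¹) κ d B α β γ hf
  have hpos : ∀ t : ℕ, 0 < d + B * t := fun t => by
    have : 0 ≤ B * t := by positivity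
    linarith
  refine norm_sum_expTwoPi_pow_four_le (by positivity) h1 h1M h2 h2M ?_ ?_ ?_
  · intro a a' t ha _ ha' _ ht
    have ha0 : (0 : ℝ) < a := by exact_mod_cast ha
    have ha0' : (0 : ℝ) < a' := by exact_mod_cast ha'
    obtain ⟨ξ, hξ, hξ', e⟩ := exists_third_diff_neg_inv_sq (hpos t) (mul_pos hB ha0)
      (mul_pos hB ha0') hB
    rw [hdiff, e]
    have hξpos : 0 < ξ := (hpos t).trans_le hξ
    have hξD : ξ ≤ 4 * D := by
      refine (hξ'.trans ?_).trans hdM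
      have : (t : ℝ) + a + a' + 1 ≤ M := by exact_mod_cast ht
      nlinarith
    calc (a : ℝ) * a' * (24 * κ * B ^ 3 / (4 * D) ^ 5)
        = κ * (B * a * (B * a') * B * (24 * ((4 * D) ^ 5)⁻¹)) := by
          field_simp
      _ ≤ _ := by gcongr
  · intro a a' t ha haH ha' haH' ht
    have ha0 : (0 : ℝ) < a := by exact_mod_cast ha
    have ha0' : (0 : ℝ) < a' := by exact_mod_cast ha'
    obtain ⟨ξ, hξ, hξ', e⟩ := exists_third_diff_neg_inv_sq (hpos t) (mul_pos hB ha0)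
      (mul_pos hB ha0') hB
    rw [hdiff, e]
    have hξD : D ≤ ξ := by
      have : 0 ≤ B * t := by positivity
      linarith
    have haH1 : (a : ℝ) ≤ H₁ := by exact_mod_cast haH.le
    have haH2 : (a' : ℝ) ≤ H₂ := by exact_mod_cast haH'.le
    have hξpos : 0 < ξ := hD.trans_le hξD
    calc κ * (B * a * (B * a') * B * (24 * (ξ ^ 5)⁻¹))
        ≤ κ * (B * H₁ * (B * H₂) * B * (24 * (D ^ 5)⁻¹)) := by gcongr
      _ = 24 * κ * B ^ 3 * (H₁ * H₂) / D ^ 5 := by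
          field_simp
      _ ≤ _ := hsmall
  · intro a a' t ha _ ha' _ ht
    have ha0 : (0 : ℝ) < a := by exact_mod_cast ha
    have ha0' : (0 : ℝ) < a' := by exact_mod_cast ha'
    have h := third_diff_neg_inv_sq_anti (hpos t) (mul_pos hB ha0) (mul_pos hB ha0') hB hB
    rw [hdiff, hdiff]
    refine mul_le_mul_of_nonneg_left ?_ hκ.le
    have c : d + B * ((t + 1 : ℕ) : ℝ) = d + B * t + B := by push_cast; ring
    rw [c]
    exact h

/-- For palindromic digit strings of equal length, the lowest `k` digits determine the highest
`k` digits. -/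
lemma div_pow_eq_of_mod_pow_eq_of_palindrome {b N k n n' : ℕ} (hb : 1 < b) (hk : k ≤ N)
    (hn : (Nat.digits b n).Palindrome) (hn' : (Nat.digits b n').Palindrome)
    (hN : (Nat.digits b n).length = N) (hN' : (Nat.digits b n').length = N)
    (h : n % b ^ k = n' % b ^ k) : n / b ^ (N - k) = n' / b ^ (N - k) := by
  have hdrop : ∀ m : ℕ, (Nat.digits b m).Palindrome → (Nat.digits b m).length = N →
      (Nat.digits b m).drop (N - k) = ((Nat.digits b m).take k).reverse := by
    intro m hm hmN
    conv_lhs => rw [← hm.reverse_eq]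
    rw [List.drop_reverse, hmN, Nat.sub_sub_self hk]
  rw [Nat.self_mod_pow_eq_ofDigits_take k n hb, Nat.self_mod_pow_eq_ofDigits_take k n' hb] at h
  have htake : (Nat.digits b n).take k = (Nat.digits b n').take k := by
    refine Nat.ofDigits_inj_of_len_eq hb (by simp [hN, hN']) ?_ ?_ h
    · exact fun l hl => Nat.digits_lt_base hb (List.mem_of_mem_take hl)
    · exact fun l hl => Nat.digits_lt_base hb (List.mem_of_mem_take hl)
  rw [Nat.self_div_pow_eq_ofDigits_drop _ n hb, Nat.self_div_pow_eq_ofDigits_drop _ n' hb,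
    hdrop n hn hN, hdrop n' hn' hN', htake]

/-- A quadratic polynomial inverting `(d₀ + B t)²` modulo `B³`, and the resulting congruence for
the cofactor of `(d₀ + B t)²` in `n`. -/
lemma dvd_sub_mul_of_mul_eq {Q B d₀ t u n m r : ℤ} (hQ : Q ∣ B ^ 3) (hu : B ^ 3 ∣ u * d₀ - 1)
    (hm : n = (d₀ + B * t) ^ 2 * m) (hr : Q ∣ n - r) :
    Q ∣ m - r * (u ^ 2 - 2 * u ^ 3 * B * t + 3 * u ^ 4 * B ^ 2 * t ^ 2) := by
  obtain ⟨w, hw⟩ := hu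
  obtain ⟨q, hq⟩ := hr
  set p := u ^ 2 - 2 * u ^ 3 * B * t + 3 * u ^ 4 * B ^ 2 * t ^ 2 with hp
  have hinv : Q ∣ (d₀ + B * t) ^ 2 * p - 1 := by
    refine hQ.trans ?_
    have hs : u * (d₀ + B * t) = 1 + u * B * t + B ^ 3 * w := by linear_combination hw
    refine ⟨4 * u ^ 3 * t ^ 3 + 3 * u ^ 4 * B * t ^ 4 +
      w * (2 * (1 + u * B * t) + B ^ 3 * w) *
        (1 - 2 * (u * B * t) + 3 * (u * B * t) ^ 2), ?_⟩
    linear_combination (u * (d₀ + B * t) + (1 + u * B * t + B ^ 3 * w)) *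
      (1 - 2 * (u * B * t) + 3 * (u * B * t) ^ 2) * hs
  obtain ⟨v, hv⟩ := hinv
  refine ⟨q * p - m * v, ?_⟩
  linear_combination p * hq - m * hv - p * hm

/-- Two multiples of `d²` in a short interval and in the same class modulo `Q` coincide. -/
lemma eq_of_sq_dvd_of_modEq {Q d n n' A L r : ℕ} (hQd : Nat.Coprime Q d) (hL : L ≤ Q * d ^ 2)
    (h1 : A ≤ n) (h2 : n < A + L) (h1' : A ≤ n') (h2' : n' < A + L)
    (hr : n % Q = r) (hr' : n' % Q = r) (hd : d ^ 2 ∣ n) (hd' : d ^ 2 ∣ n') : n = n' := by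
  have hmod : n ≡ n' [MOD Q * d ^ 2] := by
    refine (Nat.modEq_and_modEq_iff_modEq_mul (hQd.pow_right 2)).1 ⟨hr.trans hr'.symm, ?_⟩
    exact ((Nat.modEq_zero_iff_dvd).2 hd).trans ((Nat.modEq_zero_iff_dvd).2 hd').symm
  refine Nat.ModEq.eq_of_abs_lt hmod ?_
  generalize Q * d ^ 2 = w at hL
  rw [abs_lt]
  omega

/-- If `d² m` lies in `[A, A + L)` with `m ≡ r p (mod Q)`, then `-A / (Q d²) + r p / Q` is close
to an integer. -/
lemma exists_abs_phase_sub_le {A L Q D : ℝ} {n d m r p : ℤ} {Q' : ℕ} (hQ' : (Q' : ℝ) = Q)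
    (hQ : 0 < Q) (hD : 0 < D) (hDd : D ≤ d) (h1 : A ≤ n) (h2 : n ≤ A + L)
    (hm : n = d ^ 2 * m) (hp : (Q' : ℤ) ∣ m - r * p) :
    ∃ z : ℤ, |(A / Q * -(((d : ℝ)) ^ 2)⁻¹ + r * p / Q) - z| ≤ L / (Q * D ^ 2) := by
  obtain ⟨q, hq⟩ := hp
  have hd : (0 : ℝ) < d := hD.trans_le hDd
  refine ⟨-q, ?_⟩
  have hq' : (m : ℝ) - r * p = Q * q := by rw [← hQ']; exact_mod_cast hq
  have hm' : (n : ℝ) = d ^ 2 * m := by exact_mod_cast hm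
  have e : (A / Q * -(((d : ℝ)) ^ 2)⁻¹ + r * p / Q) - ((-q : ℤ) : ℝ) =
      (n - A) / (Q * d ^ 2) := by
    have : (r : ℝ) * p = m - Q * q := by linarith
    rw [this, hm']
    push_cast
    field_simp
    ring
  have hL : 0 ≤ L := by linarith
  rw [e, abs_of_nonneg (div_nonneg (by linarith) (by positivity))]
  gcongr
  linarith

/-- Elements of a residue class and a short interval having a large square divisor: the bound in
terms of exponential sums. -/
lemma card_fiber_le {A L Q B M H₁ H₂ K r : ℕ} {D S : ℝ} (F : Finset ℕ)
    (hA : 0 < A) (hQ : 0 < Q) (hB : 0 < B) (hQB : Q ∣ B ^ 3) (hD : 0 < D) (hBD : B ≤ D)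
    (hM : M = ⌊D / B⌋₊ + 1)
    (hF : ∀ n ∈ F, A ≤ n ∧ n < A + L ∧ n % Q = r ∧ Nat.Coprime n B ∧
      ∃ d : ℕ, D ≤ d ∧ (d : ℝ) ≤ 2 * D ∧ d ^ 2 ∣ n)
    (hK : 1 ≤ K) (hKL : 6 * K * L ≤ Q * D ^ 2)
    (h1 : 1 ≤ H₁) (h1M : H₁ ≤ M) (h2 : 1 ≤ H₂) (h2M : H₂ ≤ M)
    (hsmall : 24 * (K * (A / Q)) * B ^ 3 * (H₁ * H₂) / D ^ 5 ≤ (1 : ℝ) / 2)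
    (hS : 0 ≤ S)
    (hS4 : 32 * (M : ℝ) ^ 4 / H₁ ^ 2 + 128 * M ^ 4 / H₂ + 128 * M ^ 3 * (1 + Real.log M) ^ 2 /
      (H₁ * H₂ * (24 * (A / Q) * B ^ 3 / (4 * D) ^ 5)) ≤ S ^ 4) :
    (F.card : ℝ) ≤ B * (4 * M / K + 4 * S) := by
  classical
  choose! d hd using fun n hn => (hF n hn).2.2.2.2
  set D₀ := ⌈D⌉₊ with hD₀
  have hBR : (0 : ℝ) < B := by exact_mod_cast hB
  have hQR : (0 : ℝ) < Q := by exact_mod_cast hQ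
  have hAR : (0 : ℝ) < A := by exact_mod_cast hA
  have hKR : (1 : ℝ) ≤ K := by exact_mod_cast hK
  have hD₀d : ∀ n ∈ F, D₀ ≤ d n := fun n hn => Nat.ceil_le.2 (hd n hn).1
  have hcop : ∀ n ∈ F, Nat.Coprime (d n) B := fun n hn =>
    (hF n hn).2.2.2.1.coprime_dvd_left ((dvd_pow_self _ two_ne_zero).trans (hd n hn).2.2)
  set I := (Finset.Ico D₀ (D₀ + B)).filter (fun d₀ => Nat.Coprime d₀ B) with hI
  set G : ℕ → Finset ℕ := fun d₀ =>
    (Finset.range M).filter (fun t => ∃ n ∈ F, D ≤ ((d₀ + B * t : ℕ) : ℝ) ∧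
      (d₀ + B * t) ^ 2 ∣ n) with hG
  have hdecomp : ∀ n ∈ F, D₀ + (d n - D₀) % B + B * ((d n - D₀) / B) = d n := by
    intro n hn
    rw [add_assoc, Nat.mod_add_div, Nat.add_sub_cancel' (hD₀d n hn)]
  have hcard : F.card ≤ ∑ d₀ ∈ I, (G d₀).card := by
    rw [← Finset.card_sigma]
    refine Finset.card_le_card_of_injOn
      (fun n => (⟨D₀ + (d n - D₀) % B, (d n - D₀) / B⟩ : Sigma fun _ : ℕ => ℕ)) ?_ ?_
    · intro n hn
      have hn : n ∈ F := hn
      have e := hdecomp n hn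
      have hlt := Nat.mod_lt (d n - D₀) hB
      simp only [Finset.coe_sigma, Set.mem_sigma_iff, Finset.mem_coe, hI, hG, Finset.mem_filter,
        Finset.mem_Ico, Finset.mem_range]
      refine ⟨⟨⟨by omega, by omega⟩, ?_⟩, ?_, n, hn, ?_, ?_⟩
      · have h := hcop n hn
        rw [← e] at h
        simpa using h
      · rw [hM, Nat.lt_succ_iff, Nat.le_floor_iff (by positivity)]
        refine Nat.cast_div_le.trans ?_
        gcongr
        rw [Nat.cast_sub (hD₀d n hn)]
        have := Nat.le_ceil D
        linarith [(hd n hn).2.1]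
      · rw [e]; exact (hd n hn).1
      · rw [e]; exact (hd n hn).2.2
    · intro n hn n' hn' he
      have hn : n ∈ F := hn
      have hn' : n' ∈ F := hn'
      simp only [Sigma.mk.injEq, heq_eq_eq] at he
      have hdd : d n = d n' := by
        rw [← hdecomp n hn, ← hdecomp n' hn', he.1, he.2]
      obtain ⟨a1, a2, a3, -, -⟩ := hF n hn
      obtain ⟨b1, b2, b3, -, -⟩ := hF n' hn'
      have hQd : Nat.Coprime Q (d n) :=
        ((hcop n hn).symm.pow_left 3).coprime_dvd_left hQB
      refine eq_of_sq_dvd_of_modEq hQd ?_ a1 a2 b1 b2 a3 b3 (hd n hn).2.2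
        (hdd ▸ (hd n' hn').2.2)
      have hDd : D ^ 2 ≤ (d n : ℝ) ^ 2 := pow_le_pow_left₀ hD.le (hd n hn).1 2
      have hL : (L : ℝ) ≤ 6 * K * L := by
        have : (0 : ℝ) ≤ L := by positivity
        nlinarith
      have : (L : ℝ) ≤ Q * (d n : ℝ) ^ 2 :=
        (hL.trans hKL).trans (mul_le_mul_of_nonneg_left hDd hQR.le)
      exact_mod_cast this
  have hclass : ∀ d₀ ∈ I, ((G d₀).card : ℝ) ≤ 4 * M / K + 4 * S := by
    intro d₀ hd₀
    rw [hI, Finset.mem_filter, Finset.mem_Ico] at hd₀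
    obtain ⟨⟨hlow, hhigh⟩, hc⟩ := hd₀
    obtain ⟨u, hu⟩ : ∃ u : ℤ, (B : ℤ) ^ 3 ∣ u * d₀ - 1 := by
      have h := Int.isCoprime_iff_gcd_eq_one.2
        (show Int.gcd (d₀ : ℤ) ((B ^ 3 : ℕ) : ℤ) = 1 from hc.pow_right 3)
      obtain ⟨u, v, huv⟩ := h
      refine ⟨u, -v, ?_⟩
      push_cast at huv
      linear_combination huv
    have hDd₀ : D ≤ d₀ := (Nat.le_ceil D).trans (by exact_mod_cast hlow)
    have hd₀M : (d₀ : ℝ) + B * M ≤ 4 * D := by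
      have hle : (d₀ : ℝ) + 1 ≤ D₀ + B := by exact_mod_cast hhigh
      have hceil : (D₀ : ℝ) < D + 1 := Nat.ceil_lt_add_one hD.le
      have hfl : (B : ℝ) * M ≤ D + B := by
        rw [hM]
        push_cast
        have := Nat.floor_le (show 0 ≤ D / B by positivity)
        calc (B : ℝ) * (⌊D / B⌋₊ + 1) ≤ B * (D / B + 1) := by gcongr
          _ = D + B := by field_simp
      linarith
    set g : ℕ → ℝ := fun t => (A / Q : ℝ) * -((d₀ + B * t : ℝ) ^ 2)⁻¹ +
      r * (u ^ 2 - 2 * u ^ 3 * B * t + 3 * u ^ 4 * B ^ 2 * t ^ 2) / Q with hg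
    refine card_near_int_le (g := g) hK hS (G d₀) (Finset.filter_subset _ _) ?_ ?_
    · intro t ht
      simp only [hG, Finset.mem_filter, Finset.mem_range] at ht
      obtain ⟨-, n, hn, hDn, m, hm⟩ := ht
      obtain ⟨a1, a2, a3, -, -⟩ := hF n hn
      have hp := dvd_sub_mul_of_mul_eq (Q := Q) (B := B) (d₀ := d₀) (t := t) (u := u) (n := n)
        (m := m) (r := r) (by exact_mod_cast hQB) hu (by rw [hm]; push_cast; ring)
        (by rw [← a3]; push_cast; exact Int.dvd_self_sub_emod)
      obtain ⟨z, hz⟩ := exists_abs_phase_sub_le (A := A) (L := L) (D := D) (n := n)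
        (d := (d₀ + B * t : ℕ)) rfl hQR hD (by exact_mod_cast hDn)
        (by exact_mod_cast a1) (by exact_mod_cast a2.le) (by rw [hm]; push_cast; ring) hp
      refine ⟨z, ?_⟩
      have e : g t = (A / Q : ℝ) * -((((d₀ + B * t : ℕ) : ℤ) : ℝ) ^ 2)⁻¹ +
          ((r : ℤ) : ℝ) * ((u ^ 2 - 2 * u ^ 3 * B * t + 3 * u ^ 4 * B ^ 2 * t ^ 2 : ℤ) : ℝ) / Q := by
        simp only [hg]; push_cast; ring
      rw [e]
      refine hz.trans ?_
      rw [div_le_div_iff₀ (by positivity) (by positivity)]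
      linarith
    · intro h hh1 hhK
      have hhR : (1 : ℝ) ≤ h := by exact_mod_cast hh1
      have hhKR : (h : ℝ) ≤ K := by exact_mod_cast hhK.le
      have hM1 : (1 : ℝ) ≤ M := by rw [hM]; push_cast; linarith [Nat.cast_nonneg (α := ℝ) ⌊D / B⌋₊]
      have hH1 : (1 : ℝ) ≤ H₁ := by exact_mod_cast h1
      have hH2 : (1 : ℝ) ≤ H₂ := by exact_mod_cast h2
      have key := norm_sum_inv_sq_phase_pow_four_le (κ := h * (A / Q)) (d := d₀) (B := B) (D := D)
        (α := h * r * u ^ 2 / Q) (β := -(h * r * (2 * u ^ 3 * B) / Q))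
        (γ := h * r * (3 * u ^ 4 * B ^ 2) / Q) (f := fun t => h * g t) (M := M)
        (H₁ := H₁) (H₂ := H₂) (fun t => by simp only [hg]; ring) (by positivity) hBR hD hDd₀
        hd₀M h1 h1M h2 h2M (le_trans (by gcongr) hsmall)
      refine le_of_pow_le_pow_left₀ four_ne_zero hS ((key.trans ?_).trans hS4)
      gcongr
      exact le_mul_of_one_le_left (by positivity) hhR
  calc (F.card : ℝ) ≤ ∑ d₀ ∈ I, ((G d₀).card : ℝ) := by exact_mod_cast hcard
    _ ≤ ∑ _d₀ ∈ I, (4 * (M : ℝ) / K + 4 * S) := Finset.sum_le_sum hclass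
    _ = I.card * (4 * (M : ℝ) / K + 4 * S) := by rw [Finset.sum_const, nsmul_eq_mul]
    _ ≤ _ := by
      gcongr
      have := Finset.card_filter_le (Finset.Ico D₀ (D₀ + B)) (fun d₀ => Nat.Coprime d₀ B)
      simpa using this

/-- Palindromes of length `N` are determined by their lowest `k` digits when `N ≤ 2 k`. -/
lemma card_palindromes_le_pow {b N k : ℕ} (hb : 1 < b) (hk : k ≤ N) (hNk : N ≤ 2 * k)
    (F : Finset ℕ)
    (hF : ∀ n ∈ F, (Nat.digits b n).length = N ∧ (Nat.digits b n).Palindrome) :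
    F.card ≤ b ^ k := by
  have hpos : 0 < b ^ k := by positivity
  rw [← Finset.card_range (b ^ k)]
  refine Finset.card_le_card_of_injOn (· % b ^ k) ?_ ?_
  · intro n _
    simpa using Nat.mod_lt n hpos
  · intro n hn n' hn' h
    obtain ⟨h1, h2⟩ := hF n hn
    obtain ⟨h1', h2'⟩ := hF n' hn'
    have h : n % b ^ k = n' % b ^ k := h
    have hdiv := div_pow_eq_of_mod_pow_eq_of_palindrome hb hk h2 h2' h1 h1' h
    have hmod : n % b ^ (N - k) = n' % b ^ (N - k) := by
      have hdvd : b ^ (N - k) ∣ b ^ k := pow_dvd_pow b (by omega)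
      rw [← Nat.mod_mod_of_dvd n hdvd, h, Nat.mod_mod_of_dvd n' hdvd]
    rw [← Nat.div_add_mod n (b ^ (N - k)), hdiv, hmod, Nat.div_add_mod]

/-- Palindromes of length `N` with a large square divisor, split according to their lowest `k`
digits. -/
lemma card_palindromes_sq_dvd_le {b N k j M H₁ H₂ K : ℕ} {D S : ℝ} (hb : 1 < b) (hk1 : 1 ≤ k)
    (hk : k ≤ N) (hkj : k ≤ 3 * j) (hjk : 3 * j ≤ k + 2) (F : Finset ℕ)
    (hF : ∀ n ∈ F, (Nat.digits b n).length = N ∧ (Nat.digits b n).Palindrome ∧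
      Nat.Coprime n b ∧ ∃ d : ℕ, D ≤ d ∧ (d : ℝ) ≤ 2 * D ∧ d ^ 2 ∣ n)
    (hD : 0 < D) (hBD : (b : ℝ) ^ j ≤ D) (hM : M = ⌊D / (b : ℝ) ^ j⌋₊ + 1)
    (hK : 1 ≤ K) (hKL : 6 * K * (b : ℝ) ^ (N - k) ≤ b ^ k * D ^ 2)
    (h1 : 1 ≤ H₁) (h1M : H₁ ≤ M) (h2 : 1 ≤ H₂) (h2M : H₂ ≤ M)
    (hsmall : 24 * K * (b : ℝ) ^ (N + 2) * (H₁ * H₂) / D ^ 5 ≤ 1 / 2)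
    (hS : 0 ≤ S)
    (hS4 : 32 * (M : ℝ) ^ 4 / H₁ ^ 2 + 128 * M ^ 4 / H₂ + 128 * M ^ 3 * (1 + Real.log M) ^ 2 /
      (H₁ * H₂ * (24 * b ^ (N - 1) / (4 * D) ^ 5)) ≤ S ^ 4) :
    (F.card : ℝ) ≤ b ^ k * (b ^ j * (4 * M / K + 4 * S)) := by
  classical
  have hb0 : 0 < b := by omega
  have hbR : (1 : ℝ) < b := by exact_mod_cast hb
  have hbR0 : (0 : ℝ) < b := by linarith
  have hH1 : (1 : ℝ) ≤ H₁ := by exact_mod_cast h1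
  have hH2 : (1 : ℝ) ≤ H₂ := by exact_mod_cast h2
  have hfib : ∀ r ∈ Finset.range (b ^ k), ((F.filter (fun n => n % b ^ k = r)).card : ℝ) ≤
      b ^ j * (4 * M / K + 4 * S) := by
    intro r _
    rcases (F.filter (fun n => n % b ^ k = r)).eq_empty_or_nonempty with he | ⟨n₀, hn₀⟩
    · rw [he]; simp only [Finset.card_empty, Nat.cast_zero]; positivity
    rw [Finset.mem_filter] at hn₀
    obtain ⟨hn₀F, hn₀r⟩ := hn₀
    obtain ⟨l₀, p₀, -, -⟩ := hF n₀ hn₀F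
    have hn₀0 : n₀ ≠ 0 := by
      rintro rfl
      simp only [Nat.digits_zero, List.length_nil] at l₀
      omega
    set A := b ^ (N - k) * (n₀ / b ^ (N - k)) with hAdef
    have hAlow : b ^ (N - 1) ≤ A := by
      have h : b ^ (N - 1) ≤ n₀ := by
        have := Nat.base_pow_length_digits_le' (b - 2) n₀ hn₀0
        rw [show b - 2 + 2 = b by omega, l₀, show N = (N - 1) + 1 by omega, pow_succ,
          mul_comm] at this
        exact Nat.le_of_mul_le_mul_left this hb0
      have e : b ^ (N - 1) = b ^ (N - k) * b ^ (k - 1) := by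
        rw [← pow_add]; congr 1; omega
      rw [hAdef, e]
      refine Nat.mul_le_mul_left _ ?_
      rw [Nat.le_div_iff_mul_le (by positivity), mul_comm, ← e]
      exact h
    have hAup : A ≤ b ^ N := by
      have h : n₀ < b ^ N := by
        rw [← l₀]; exact Nat.lt_base_pow_length_digits hb
      exact (Nat.mul_div_le _ _).trans h.le
    have hAlowR : (b : ℝ) ^ (N - 1) ≤ A := by exact_mod_cast hAlow
    have hAupR : (A : ℝ) ≤ b ^ N := by exact_mod_cast hAup
    have hA0 : 0 < A := lt_of_lt_of_le (by positivity) hAlow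
    have hBQ : (b : ℝ) ^ k ≤ (b ^ j) ^ 3 := by
      rw [← pow_mul]; exact pow_le_pow_right₀ hbR.le (by omega)
    have hBQ' : ((b : ℝ) ^ j) ^ 3 ≤ b ^ 2 * b ^ k := by
      rw [← pow_mul, ← pow_add]; exact pow_le_pow_right₀ hbR.le (by omega)
    have key := card_fiber_le (A := A) (L := b ^ (N - k)) (Q := b ^ k) (B := b ^ j) (M := M)
      (H₁ := H₁) (H₂ := H₂) (K := K) (r := r) (D := D) (S := S)
      (F.filter (fun n => n % b ^ k = r)) hA0 (by positivity) (by positivity)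
      (by rw [← pow_mul]; exact pow_dvd_pow b (by omega)) hD (by exact_mod_cast hBD)
      (by exact_mod_cast hM) ?_ hK (by exact_mod_cast hKL) h1 h1M h2 h2M ?_ hS ?_
    · exact_mod_cast key
    · intro n hn
      rw [Finset.mem_filter] at hn
      obtain ⟨hnF, hnr⟩ := hn
      obtain ⟨l, p, c, hd⟩ := hF n hnF
      have hdiv := div_pow_eq_of_mod_pow_eq_of_palindrome hb hk p p₀ l l₀ (hnr.trans hn₀r.symm)
      refine ⟨?_, ?_, hnr, c.pow_right j, hd⟩
      · rw [hAdef, ← hdiv]; exact Nat.mul_div_le _ _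
      · rw [hAdef, ← hdiv]
        exact Nat.lt_mul_div_succ n (by positivity)
    · refine le_trans ?_ hsmall
      push_cast
      gcongr ?_ / _
      calc 24 * ((K : ℝ) * (A / b ^ k)) * (b ^ j) ^ 3 * (H₁ * H₂)
          ≤ 24 * ((K : ℝ) * (b ^ N / b ^ k)) * (b ^ 2 * b ^ k) * (H₁ * H₂) := by gcongr
        _ = _ := by rw [pow_add]; field_simp
    · refine le_trans ?_ hS4
      push_cast
      gcongr _ + _ / (_ * (?_ / _))
      calc 24 * (b : ℝ) ^ (N - 1) = 24 * (b ^ (N - 1) / b ^ k) * b ^ k := by field_simp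
        _ ≤ 24 * (A / b ^ k) * (b ^ j) ^ 3 := by gcongr
  have hsum : F.card = ∑ r ∈ Finset.range (b ^ k), (F.filter (fun n => n % b ^ k = r)).card :=
    Finset.card_eq_sum_card_fiberwise (fun n _ => by
      simpa using Nat.mod_lt n (show 0 < b ^ k by positivity))
  calc (F.card : ℝ)
      = ∑ r ∈ Finset.range (b ^ k), ((F.filter (fun n => n % b ^ k = r)).card : ℝ) := by
        exact_mod_cast hsum
    _ ≤ ∑ _r ∈ Finset.range (b ^ k), (b ^ j * (4 * (M : ℝ) / K + 4 * S)) :=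
        Finset.sum_le_sum hfib
    _ = _ := by rw [Finset.sum_const, nsmul_eq_mul, Finset.card_range]; push_cast; rfl

/-- Monomial inequalities between the parameters of the exponential sum argument. -/
lemma param_inequalities {x D T Y B P₁ P₂ Z : ℝ} (hx : 1 ≤ x) (hD : 0 < D) (hT : 0 < T)
    (hY : 0 < Y) (hB : 0 < B) (hP₁ : 0 < P₁) (hP₂ : 0 < P₂) (hZ : 0 < Z)
    (lZ : Real.log Z = Real.log x / 1000) (lP₁ : Real.log P₁ = Real.log x / 10)
    (lP₂ : Real.log P₂ = 4 * Real.log D - 22 / 25 * Real.log x)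
    (lT : Real.log T = 7 / 11 * Real.log x - 13 / 22 * Real.log D)
    (lD : 3 / 13 * Real.log x ≤ Real.log D) (lD' : Real.log D ≤ 8 / 31 * Real.log x)
    (lY : Real.log Y ≤ Real.log x) (hBY : B ^ 3 * (D * T) ≤ Z * Y) :
    (Z * Y ^ 4 ≤ T ^ 8 * P₁ ^ 2 ∧ Z * Y ^ 4 ≤ T ^ 8 * P₂ ∧
      Z * (D ^ 4 * Y ^ 3 * B) ≤ T ^ 8 * (P₁ * P₂)) ∧
    Z * (Y ^ 2 * (P₁ * P₂)) ≤ T ^ 2 * D ^ 5 ∧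
    (Z * (Y * P₁ ^ 3) ≤ D ^ 4 * T ∧ Z * (Y * P₂ ^ 3) ≤ D ^ 4 * T) ∧
    1 ≤ P₁ ∧ 1 ≤ P₂ := by
  have hl : 0 ≤ Real.log x := Real.log_nonneg hx
  have hx0 : 0 < x := by linarith
  rw [← Real.exp_log hD, ← Real.exp_log hT, ← Real.exp_log hY, ← Real.exp_log hB,
    ← Real.exp_log hP₁, ← Real.exp_log hP₂, ← Real.exp_log hZ]
  rw [← Real.exp_log hD, ← Real.exp_log hT, ← Real.exp_log hY, ← Real.exp_log hB,
    ← Real.exp_log hZ] at hBY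
  generalize Real.log x = l at *
  generalize Real.log D = a at *
  generalize Real.log T = t at *
  generalize Real.log Y = y at *
  generalize Real.log B = β at *
  generalize Real.log P₁ = p at *
  generalize Real.log P₂ = q at *
  generalize Real.log Z = z at *
  simp only [← Real.exp_nat_mul, ← Real.exp_add, Real.exp_le_exp, Real.one_le_exp_iff]
    at hBY ⊢
  push_cast at hBY ⊢
  refine ⟨⟨?_, ?_, ?_⟩, ?_, ⟨?_, ?_⟩, ?_, ?_⟩ <;> linarith

/-- Size of the saving `T` compared to `D` and `x`. -/
lemma saving_inequalities {x D T Z : ℝ} (hx : 1 ≤ x) (hD : 0 < D) (hT : 0 < T) (hZ : 0 < Z)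
    (lZ : Real.log Z = Real.log x / 1000)
    (lT : Real.log T = 7 / 11 * Real.log x - 13 / 22 * Real.log D)
    (lD : 3 / 13 * Real.log x ≤ Real.log D) (lD' : Real.log D ≤ 8 / 31 * Real.log x) :
    Z ≤ D * T ∧ D ≤ T ∧ Z * D ≤ x := by
  have hl : 0 ≤ Real.log x := Real.log_nonneg hx
  have hx0 : 0 < x := by linarith
  rw [← Real.exp_log hx0, ← Real.exp_log hD, ← Real.exp_log hT, ← Real.exp_log hZ]
  generalize Real.log x = l at *
  generalize Real.log D = a at *
  generalize Real.log T = t at *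
  generalize Real.log Z = z at *
  simp only [← Real.exp_add, Real.exp_le_exp]
  refine ⟨?_, ?_, ?_⟩ <;> linarith


/-- Verification of the fourth power bound for the exponential sums. -/
lemma exp_sum_bound_le_pow_four {b x D T Y B P₁ P₂ Z M H₁ H₂ : ℝ} (hb : 0 < b)
    (hx : 0 ≤ Real.log x)
    (hD : 0 < D) (hT : 0 < T) (hY0 : 0 < Y) (hB0 : 0 < B) (hP₁0 : 0 < P₁) (hP₂0 : 0 < P₂)
    (hbZ : 6144 * b ^ 4 ≤ Z) (hxZ : 131072 * b ^ 4 * (1 + Real.log x) ^ 2 ≤ Z)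
    (hM0 : 1 ≤ M) (hM2 : M ≤ 2 * (D / B)) (hMx : Real.log M ≤ Real.log x)
    (hH1 : P₁ ≤ H₁) (hH2 : P₂ ≤ H₂)
    (i1 : Z * Y ^ 4 ≤ T ^ 8 * P₁ ^ 2) (i2 : Z * Y ^ 4 ≤ T ^ 8 * P₂)
    (i3 : Z * (D ^ 4 * Y ^ 3 * B) ≤ T ^ 8 * (P₁ * P₂)) :
    32 * M ^ 4 / H₁ ^ 2 + 128 * M ^ 4 / H₂ + 128 * M ^ 3 * (1 + Real.log M) ^ 2 /
      (H₁ * H₂ * (24 * Y / (4 * D) ^ 5)) ≤ (D * T ^ 2 / (b * Y * B)) ^ 4 := by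
  have hH1' : 0 < H₁ := hP₁0.trans_le hH1
  have hH2' : 0 < H₂ := hP₂0.trans_le hH2
  have hb4 : 0 < b ^ 4 := by positivity
  set S : ℝ := D * T ^ 2 / (b * Y * B) with hSdef
  have e : S ^ 4 = D ^ 4 * T ^ 8 / (b ^ 4 * Y ^ 4 * B ^ 4) := by rw [hSdef]; field_simp
  have f1 : 32 * M ^ 4 / H₁ ^ 2 ≤ S ^ 4 / 3 := by
    calc 32 * M ^ 4 / H₁ ^ 2 ≤ 32 * (2 * (D / B)) ^ 4 / P₁ ^ 2 := by gcongr
      _ = 512 * D ^ 4 / B ^ 4 / P₁ ^ 2 := by field_simp; norm_num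
      _ ≤ S ^ 4 / 3 := by
        rw [e, div_div, div_div, div_le_div_iff₀ (by positivity) (by positivity)]
        calc 512 * D ^ 4 * (b ^ 4 * Y ^ 4 * B ^ 4 * 3)
            = D ^ 4 * B ^ 4 * (1536 * b ^ 4 * Y ^ 4) := by ring
          _ ≤ D ^ 4 * B ^ 4 * (Z * Y ^ 4) := by gcongr; linarith
          _ ≤ D ^ 4 * B ^ 4 * (T ^ 8 * P₁ ^ 2) := by gcongr
          _ = _ := by ring
  have f2 : 128 * M ^ 4 / H₂ ≤ S ^ 4 / 3 := by
    calc 128 * M ^ 4 / H₂ ≤ 128 * (2 * (D / B)) ^ 4 / P₂ := by gcongr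
      _ = 2048 * D ^ 4 / B ^ 4 / P₂ := by field_simp; norm_num
      _ ≤ S ^ 4 / 3 := by
        rw [e, div_div, div_div, div_le_div_iff₀ (by positivity) (by positivity)]
        calc 2048 * D ^ 4 * (b ^ 4 * Y ^ 4 * B ^ 4 * 3)
            = D ^ 4 * B ^ 4 * (6144 * b ^ 4 * Y ^ 4) := by ring
          _ ≤ D ^ 4 * B ^ 4 * (Z * Y ^ 4) := by gcongr
          _ ≤ D ^ 4 * B ^ 4 * (T ^ 8 * P₂) := by gcongr
          _ = _ := by ring
  have f3 : 128 * M ^ 3 * (1 + Real.log M) ^ 2 / (H₁ * H₂ * (24 * Y / (4 * D) ^ 5)) ≤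
      S ^ 4 / 3 := by
    have hlM : 0 ≤ Real.log M := Real.log_nonneg hM0
    calc 128 * M ^ 3 * (1 + Real.log M) ^ 2 / (H₁ * H₂ * (24 * Y / (4 * D) ^ 5))
        ≤ 128 * (2 * (D / B)) ^ 3 * (1 + Real.log x) ^ 2 /
          (P₁ * P₂ * (24 * Y / (4 * D) ^ 5)) := by gcongr
      _ = 131072 * (1 + Real.log x) ^ 2 * D ^ 8 / (3 * B ^ 3 * (P₁ * P₂) * Y) := by
        field_simp; norm_num
      _ ≤ S ^ 4 / 3 := by
        rw [e, div_div, div_le_div_iff₀ (by positivity) (by positivity)]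
        calc 131072 * (1 + Real.log x) ^ 2 * D ^ 8 * (b ^ 4 * Y ^ 4 * B ^ 4 * 3)
            = 3 * D ^ 4 * B ^ 3 * Y * ((131072 * b ^ 4 * (1 + Real.log x) ^ 2) *
                (D ^ 4 * Y ^ 3 * B)) := by ring
          _ ≤ 3 * D ^ 4 * B ^ 3 * Y * (Z * (D ^ 4 * Y ^ 3 * B)) := by
            gcongr
          _ ≤ 3 * D ^ 4 * B ^ 3 * Y * (T ^ 8 * (P₁ * P₂)) := by gcongr
          _ = _ := by ring
  linarith

/-- Palindromes of fixed length with a large square divisor, for suitable parameters. -/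
lemma card_palindromes_length_le_of_params {b N k j : ℕ} {x D T Y Z P₁ P₂ Q B : ℝ} (hb1 : 1 < b)
    (hk1 : 1 ≤ k) (hkN : k ≤ N) (hkj : k ≤ 3 * j) (hjk : 3 * j ≤ k + 2)
    (hQdef : Q = (b : ℝ) ^ k) (hBdef : B = (b : ℝ) ^ j) (hYdef : Y = (b : ℝ) ^ (N - 1))
    (F : Finset ℕ)
    (hF : ∀ n ∈ F, (Nat.digits b n).length = N ∧ (Nat.digits b n).Palindrome ∧
      Nat.Coprime n b ∧ ∃ d : ℕ, D ≤ d ∧ (d : ℝ) ≤ 2 * D ∧ d ^ 2 ∣ n)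
    (hx : 1 ≤ x) (hD : 0 < D) (hT0 : 0 < T) (hYT : 6 * T ^ 2 < Y)
    (hbZ : 6144 * (b : ℝ) ^ 4 ≤ Z) (hb6Z : 32 * (b : ℝ) ^ 6 ≤ Z)
    (hxZ : 131072 * (b : ℝ) ^ 4 * (1 + Real.log x) ^ 2 ≤ Z) (hDx : 2 * D ≤ x)
    (hQ2 : Q * (D * T) ≤ b * (b * Y)) (hQ3 : b * Y ≤ Q * (D * T))
    (hP₁1 : 1 ≤ P₁) (hP₂1 : 1 ≤ P₂) (hPB1 : 2 * P₁ ≤ D / B) (hPB2 : 2 * P₂ ≤ D / B)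
    (i1 : Z * Y ^ 4 ≤ T ^ 8 * P₁ ^ 2) (i2 : Z * Y ^ 4 ≤ T ^ 8 * P₂)
    (i3 : Z * (D ^ 4 * Y ^ 3 * B) ≤ T ^ 8 * (P₁ * P₂))
    (i4 : Z * (Y ^ 2 * (P₁ * P₂)) ≤ T ^ 2 * D ^ 5) :
    (F.card : ℝ) ≤ 100 * b * T := by
  have hbR1 : (1 : ℝ) ≤ b := by exact_mod_cast hb1.le
  have hbR0 : (0 : ℝ) < b := by linarith
  have hY0 : 0 < Y := by rw [hYdef]; positivity
  have hQ0 : 0 < Q := by rw [hQdef]; positivity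
  have hB1 : 1 ≤ B := by rw [hBdef]; exact one_le_pow₀ hbR1
  have hB0 : 0 < B := by linarith
  have hXY : (b : ℝ) ^ N = b * Y := by
    rw [hYdef, ← pow_succ']; congr 1; omega
  have hBD : B ≤ D := by
    have : 1 ≤ D / B := by linarith
    rwa [one_le_div hB0] at this
  set M := ⌊D / B⌋₊ + 1 with hM
  have hM1 : D / B ≤ M := by
    rw [hM]; push_cast; exact (Nat.lt_floor_add_one _).le
  have hM2 : (M : ℝ) ≤ 2 * (D / B) := by
    have := Nat.floor_le (show 0 ≤ D / B by positivity)
    rw [hM]; push_cast; linarith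
  have hM0 : (1 : ℝ) ≤ M := by linarith
  have hMx : Real.log M ≤ Real.log x := by
    refine Real.log_le_log (by linarith) (le_trans ?_ hDx)
    have : D / B ≤ D := div_le_self hD.le hB1
    linarith
  have hceil : ∀ P : ℝ, 1 ≤ P → (P ≤ (⌈P⌉₊ : ℝ)) ∧ (⌈P⌉₊ : ℝ) ≤ 2 * P := fun P hP =>
    ⟨Nat.le_ceil P, by have := Nat.ceil_lt_add_one (show 0 ≤ P by linarith); linarith⟩
  obtain ⟨hH1, hH1'⟩ := hceil P₁ hP₁1
  obtain ⟨hH2, hH2'⟩ := hceil P₂ hP₂1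
  set H₁ := ⌈P₁⌉₊
  set H₂ := ⌈P₂⌉₊
  set v : ℝ := Q ^ 2 * D ^ 2 / (6 * (b * Y)) with hv
  have hv1 : 1 ≤ v := by
    rw [hv, one_le_div (by positivity)]
    have h : (b * Y) ^ 2 ≤ (Q * (D * T)) ^ 2 := by gcongr
    refine le_of_mul_le_mul_right ?_ (show 0 < T ^ 2 by positivity)
    calc 6 * (b * Y) * T ^ 2 = b * Y * (6 * T ^ 2) := by ring
      _ ≤ b * Y * (b * Y) := by
        gcongr b * Y * ?_
        exact hYT.le.trans (le_mul_of_one_le_left hY0.le hbR1)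
      _ = (b * Y) ^ 2 := by ring
      _ ≤ (Q * (D * T)) ^ 2 := h
      _ = _ := by ring
  have hv2 : v ≤ b ^ 3 * Y / (6 * T ^ 2) := by
    have h : (Q * (D * T)) ^ 2 ≤ (b * (b * Y)) ^ 2 := by gcongr
    rw [hv, div_le_div_iff₀ (by positivity) (by positivity)]
    calc Q ^ 2 * D ^ 2 * (6 * T ^ 2) = 6 * (Q * (D * T)) ^ 2 := by ring
      _ ≤ 6 * (b * (b * Y)) ^ 2 := by gcongr
      _ = _ := by ring
  set K := ⌊v⌋₊ with hKdef
  have hK1 : 1 ≤ K := Nat.one_le_floor_iff v |>.2 hv1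
  have hK1R : (1 : ℝ) ≤ K := by exact_mod_cast hK1
  have hKv : (K : ℝ) ≤ v := Nat.floor_le (by linarith)
  have hvK : v ≤ 2 * K := by
    have := Nat.lt_floor_add_one v
    linarith
  set S : ℝ := D * T ^ 2 / (b * Y * B) with hSdef
  have hS0 : 0 ≤ S := by positivity
  have main := card_palindromes_sq_dvd_le (b := b) (N := N) (k := k) (j := j) (M := M)
    (H₁ := H₁) (H₂ := H₂) (K := K) (D := D) (S := S) hb1 hk1 hkN hkj hjk F
    hF hD (hBdef ▸ hBD) (hBdef ▸ hM) hK1 ?_ (by exact_mod_cast hP₁1.trans hH1)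
    (by exact_mod_cast (by linarith : (H₁ : ℝ) ≤ M)) (by exact_mod_cast hP₂1.trans hH2)
    (by exact_mod_cast (by linarith : (H₂ : ℝ) ≤ M)) ?_ hS0 ?_
  · rw [← hQdef, ← hBdef] at main
    refine main.trans ?_
    have hM' : (M : ℝ) * B ≤ 2 * D := by
      calc (M : ℝ) * B ≤ 2 * (D / B) * B := by gcongr
        _ = 2 * D := by field_simp
    calc Q * (B * (4 * M / K + 4 * S)) = 4 * Q * (M * B) / K + 4 * Q * D * T ^ 2 / (b * Y) := by
          rw [hSdef]; field_simp
      _ ≤ 4 * Q * (2 * D) / (v / 2) + 4 * (Q * (D * T)) * T / (b * Y) := by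
          gcongr ?_ + ?_
          · gcongr
            linarith
          · exact le_of_eq (by ring)
      _ ≤ 96 * T + 4 * (b * (b * Y)) * T / (b * Y) := by
          gcongr ?_ + ?_
          · have e : 4 * Q * (2 * D) / (v / 2) = 96 * (b * Y) / (Q * D) := by
              rw [hv]; field_simp; norm_num
            rw [e, div_le_iff₀ (by positivity)]
            linarith
          · gcongr
      _ = (96 + 4 * b) * T := by field_simp
      _ ≤ 100 * b * T := by gcongr; linarith
  · rw [← hQdef]
    have e : (b : ℝ) ^ (N - k) * Q = b * Y := by
      rw [← hXY, hQdef, ← pow_add]; congr 1; omega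
    refine le_of_mul_le_mul_right ?_ hQ0
    calc 6 * (K : ℝ) * b ^ (N - k) * Q = 6 * K * (b ^ (N - k) * Q) := by ring
      _ ≤ 6 * v * (b * Y) := by rw [e]; gcongr
      _ = Q * D ^ 2 * Q := by rw [hv]; field_simp
  · rw [div_le_iff₀ (by positivity), pow_add, hXY]
    calc 24 * (K : ℝ) * (b * Y * b ^ 2) * (H₁ * H₂)
        ≤ 24 * (b ^ 3 * Y / (6 * T ^ 2)) * (b * Y * b ^ 2) * ((2 * P₁) * (2 * P₂)) := by
          gcongr
          exact hKv.trans hv2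
      _ = 16 * b ^ 6 * (Y ^ 2 * (P₁ * P₂)) / T ^ 2 := by field_simp; ring
      _ ≤ (1 / 2 * Z) * (Y ^ 2 * (P₁ * P₂)) / T ^ 2 := by gcongr ?_ * _ / _; linarith
      _ = 1 / 2 * (Z * (Y ^ 2 * (P₁ * P₂)) / T ^ 2) := by ring
      _ ≤ 1 / 2 * D ^ 5 := by
          gcongr
          rw [div_le_iff₀ (by positivity)]
          linarith
  · rw [← hYdef]
    exact exp_sum_bound_le_pow_four hbR0 (Real.log_nonneg hx) hD hT0 hY0 hB0 (by linarith)
      (by linarith) hbZ hxZ hM0 hM2 hMx hH1 hH2 i1 i2 i3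

/-- Palindromes of fixed length with a large square divisor. -/
lemma card_palindromes_length_le {b N : ℕ} {x D T : ℝ} (hb : 2 ≤ b) (hN : 1 ≤ N) (hx : 1 ≤ x)
    (hxZ : 10 ^ 6 * b ^ 8 * (1 + Real.log x) ^ 2 ≤ x ^ ((1 : ℝ) / 1000)) (hD : 0 < D)
    (hT : T = x ^ ((7 : ℝ) / 11) / D ^ ((13 : ℝ) / 22)) (hD1 : x ^ ((3 : ℝ) / 13) ≤ D)
    (hD2 : D ≤ x ^ ((8 : ℝ) / 31)) (hNx : (b : ℝ) ^ (N - 1) ≤ x) (F : Finset ℕ)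
    (hF : ∀ n ∈ F, (Nat.digits b n).length = N ∧ (Nat.digits b n).Palindrome ∧
      Nat.Coprime n b ∧ ∃ d : ℕ, D ≤ d ∧ (d : ℝ) ≤ 2 * D ∧ d ^ 2 ∣ n) :
    (F.card : ℝ) ≤ 100 * b * T := by
  have hx0 : 0 < x := by linarith
  have hl : 0 ≤ Real.log x := Real.log_nonneg hx
  have hT0 : 0 < T := by rw [hT]; positivity
  have hb1 : 1 < b := hb
  have hbR : (2 : ℝ) ≤ b := by exact_mod_cast hb
  have hbR1 : (1 : ℝ) ≤ b := by linarith
  have hbR0 : (0 : ℝ) < b := by linarith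
  set Y : ℝ := (b : ℝ) ^ (N - 1) with hYdef
  have hY0 : 0 < Y := by positivity
  have hXY : (b : ℝ) ^ N = b * Y := by
    rw [hYdef, ← pow_succ']; congr 1; omega
  rcases le_or_gt Y (6 * T ^ 2) with hYT | hYT
  · have h1 := card_palindromes_le_pow (N := N) (k := (N + 1) / 2) hb1 (by omega) (by omega) F
      (fun n hn => ⟨(hF n hn).1, (hF n hn).2.1⟩)
    have h2 : ((b : ℝ) ^ ((N + 1) / 2)) ^ 2 ≤ (3 * b * T) ^ 2 := by
      calc ((b : ℝ) ^ ((N + 1) / 2)) ^ 2 ≤ b ^ (N + 1) := by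
            rw [← pow_mul]; exact pow_le_pow_right₀ hbR1 (by omega)
        _ = b ^ 2 * Y := by rw [pow_succ, hXY]; ring
        _ ≤ b ^ 2 * (6 * T ^ 2) := by gcongr
        _ ≤ _ := by nlinarith [sq_nonneg ((b : ℝ) * T)]
    have h3 := le_of_pow_le_pow_left₀ two_ne_zero (by positivity) h2
    calc (F.card : ℝ) ≤ (b : ℝ) ^ ((N + 1) / 2) := by exact_mod_cast h1
      _ ≤ 3 * b * T := h3
      _ ≤ 100 * b * T := by gcongr; norm_num
  set Z : ℝ := x ^ ((1 : ℝ) / 1000) with hZdef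
  set P₁ : ℝ := x ^ ((1 : ℝ) / 10) with hP₁def
  set P₂ : ℝ := D ^ (4 : ℝ) / x ^ ((22 : ℝ) / 25) with hP₂def
  have hZ0 : 0 < Z := by positivity
  have hP₁0 : 0 < P₁ := by positivity
  have hP₂0 : 0 < P₂ := by positivity
  have hlsq : 1 ≤ (1 + Real.log x) ^ 2 := one_le_pow₀ (by linarith)
  have hZ8 : 10 ^ 6 * (b : ℝ) ^ 8 ≤ Z := by
    refine le_trans ?_ hxZ
    exact le_mul_of_one_le_right (by positivity) hlsq
  have hb48 : (b : ℝ) ^ 4 ≤ b ^ 8 := pow_le_pow_right₀ hbR1 (by norm_num)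
  have hb18 : (b : ℝ) ≤ b ^ 8 := le_self_pow₀ hbR1 (by norm_num)
  have hb68 : (b : ℝ) ^ 6 ≤ b ^ 8 := pow_le_pow_right₀ hbR1 (by norm_num)
  have lZ : Real.log Z = Real.log x / 1000 := by rw [hZdef, Real.log_rpow hx0]; ring
  have lP₁ : Real.log P₁ = Real.log x / 10 := by rw [hP₁def, Real.log_rpow hx0]; ring
  have lP₂ : Real.log P₂ = 4 * Real.log D - 22 / 25 * Real.log x := by
    rw [hP₂def, Real.log_div (by positivity) (by positivity), Real.log_rpow hx0,
      Real.log_rpow hD]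
  have lT : Real.log T = 7 / 11 * Real.log x - 13 / 22 * Real.log D := by
    rw [hT, Real.log_div (by positivity) (by positivity), Real.log_rpow hx0, Real.log_rpow hD]
  have lD : 3 / 13 * Real.log x ≤ Real.log D := by
    rw [← Real.log_rpow hx0]; exact Real.log_le_log (by positivity) hD1
  have lD' : Real.log D ≤ 8 / 31 * Real.log x := by
    rw [← Real.log_rpow hx0]; exact Real.log_le_log hD hD2
  have lY : Real.log Y ≤ Real.log x := Real.log_le_log hY0 hNx
  have param := fun {B : ℝ} (hB : 0 < B) (hBY : B ^ 3 * (D * T) ≤ Z * Y) =>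
    param_inequalities hx hD hT0 hY0 hB hP₁0 hP₂0 hZ0 lZ lP₁ lP₂ lT lD lD' lY hBY
  obtain ⟨hDT, hDleT, hZDx⟩ := saving_inequalities hx hD hT0 hZ0 lZ lT lD lD'
  obtain ⟨i, hi, hi'⟩ := exists_nat_pow_near (x := b * Y / (D * T)) (y := (b : ℝ)) (by
    rw [le_div_iff₀ (by positivity)]
    nlinarith) (by linarith)
  set k := i + 1 with hk
  set Q : ℝ := (b : ℝ) ^ k with hQdef
  have hQ0 : 0 < Q := by positivity
  have hQ1 : b * Y / (D * T) ≤ Q := hi'.le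
  have hQ2 : Q * (D * T) ≤ b * (b * Y) := by
    rw [hQdef, hk, pow_succ', mul_assoc]
    rw [le_div_iff₀ (by positivity)] at hi
    gcongr
  have hQ3 : b * Y ≤ Q * (D * T) := by
    rwa [div_le_iff₀ (by positivity)] at hQ1
  have hkN : k ≤ N := by
    rw [← pow_le_pow_iff_right₀ (show (1 : ℝ) < b by linarith), hXY]
    have : b * Q ≤ b * (b * Y) := by
      refine le_trans ?_ hQ2
      rw [mul_comm]
      gcongr
      linarith
    exact le_of_mul_le_mul_left this hbR0
  set j := (k + 2) / 3 with hj
  set B : ℝ := (b : ℝ) ^ j with hBdef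
  have hB1 : 1 ≤ B := one_le_pow₀ hbR1
  have hB0 : 0 < B := by linarith
  have hB3 : B ^ 3 ≤ b ^ 2 * Q := by
    rw [hBdef, hQdef, ← pow_mul, ← pow_add]; exact pow_le_pow_right₀ hbR1 (by omega)
  have hBY4 : B ^ 3 * (D * T) ≤ b ^ 4 * Y := by
    calc B ^ 3 * (D * T) ≤ b ^ 2 * Q * (D * T) := by gcongr
      _ = b ^ 2 * (Q * (D * T)) := by ring
      _ ≤ b ^ 2 * (b * (b * Y)) := by gcongr
      _ = _ := by ring
  obtain ⟨⟨i1, i2, i3⟩, i4, ⟨i5, i6⟩, hP₁1, hP₂1⟩ := param hB0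
    (hBY4.trans (by gcongr; linarith))
  have hPB : ∀ P : ℝ, 0 < P → Z * (Y * P ^ 3) ≤ D ^ 4 * T → 2 * P ≤ D / B := by
    intro P hP h
    rw [le_div_iff₀ hB0]
    refine le_of_pow_le_pow_left₀ three_ne_zero hD.le ?_
    refine le_of_mul_le_mul_right ?_ (show 0 < D * T by positivity)
    calc (2 * P * B) ^ 3 * (D * T) = 8 * P ^ 3 * (B ^ 3 * (D * T)) := by ring
      _ ≤ 8 * P ^ 3 * (b ^ 4 * Y) := by gcongr
      _ = 8 * b ^ 4 * (Y * P ^ 3) := by ring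
      _ ≤ Z * (Y * P ^ 3) := by gcongr; linarith
      _ ≤ D ^ 4 * T := h
      _ = _ := by ring
  have hPB1 := hPB P₁ hP₁0 i5
  have hPB2 := hPB P₂ hP₂0 i6
  exact card_palindromes_length_le_of_params hb1 (by omega) hkN (by omega) (by omega) hQdef hBdef
    hYdef F hF hx hD hT0 hYT (by linarith) (by linarith)
    (le_trans (by gcongr; norm_num) hxZ) (le_trans (by gcongr; linarith) hZDx) hQ2 hQ3
    hP₁1 hP₂1 (hPB P₁ hP₁0 i5) (hPB P₂ hP₂0 i6) i1 i2 i3 i4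

/-- The power `x ^ (1/1000)` eventually dominates a constant times `(1 + log x)²`. -/
lemma exists_forall_mul_log_sq_le_rpow {c : ℝ} (hc : 1 ≤ c) :
    ∃ x₀ : ℝ, 1 ≤ x₀ ∧ ∀ x : ℝ, x₀ ≤ x → c * (1 + Real.log x) ^ 2 ≤ x ^ ((1 : ℝ) / 1000) := by
  set w : ℝ := c * 4001 ^ 2 with hw
  have hw1 : 1 ≤ w := by rw [hw]; linarith
  refine ⟨w ^ (2000 : ℝ), Real.one_le_rpow hw1 (by norm_num), fun x hx => ?_⟩
  have hx1 : 1 ≤ x := (Real.one_le_rpow hw1 (by norm_num)).trans hx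
  have hx0 : 0 ≤ x := by linarith
  have hl : 0 ≤ Real.log x := Real.log_nonneg hx1
  have hlog : 1 + Real.log x ≤ 4001 * x ^ ((1 : ℝ) / 4000) := by
    have h1 := Real.log_le_rpow_div hx0 (show (0 : ℝ) < 1 / 4000 by norm_num)
    have h2 : 1 ≤ x ^ ((1 : ℝ) / 4000) := Real.one_le_rpow hx1 (by norm_num)
    rw [le_div_iff₀ (by norm_num)] at h1
    linarith
  have hwx : w ≤ x ^ ((1 : ℝ) / 2000) := by
    have h := Real.rpow_le_rpow (by positivity) hx (show (0 : ℝ) ≤ 1 / 2000 by norm_num)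
    rwa [← Real.rpow_mul (by linarith), show (2000 : ℝ) * (1 / 2000) = 1 by norm_num,
      Real.rpow_one] at h
  calc c * (1 + Real.log x) ^ 2 ≤ c * (4001 * x ^ ((1 : ℝ) / 4000)) ^ 2 := by gcongr
    _ = w * x ^ ((1 : ℝ) / 2000) := by
      rw [mul_pow, ← Real.rpow_natCast (x ^ ((1 : ℝ) / 4000)), ← Real.rpow_mul hx0, hw]
      norm_num
      ring
    _ ≤ x ^ ((1 : ℝ) / 2000) * x ^ ((1 : ℝ) / 2000) := by gcongr
    _ = _ := by rw [← Real.rpow_add (by linarith)]; norm_num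

/-- Reduction of the count to palindromes of fixed length. -/
lemma Scount_le_of_forall_length {b : ℕ} {x D c : ℝ} (hb : 2 ≤ b) (hx : 1 ≤ x) (hc : 0 ≤ c)
    (h : ∀ (N : ℕ) (F : Finset ℕ), 1 ≤ N → (b : ℝ) ^ (N - 1) ≤ x →
      (∀ n ∈ F, (Nat.digits b n).length = N ∧ (Nat.digits b n).Palindrome ∧
        Nat.Coprime n b ∧ ∃ d : ℕ, D ≤ d ∧ (d : ℝ) ≤ 2 * D ∧ d ^ 2 ∣ n) → (F.card : ℝ) ≤ c) :
    (Scount b x D : ℝ) ≤ 3 * (1 + Real.log x) * c := by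
  classical
  set F := (Finset.Icc 1 ⌊x⌋₊).filter (fun n => n ∈ PstarSet b x ∧
    ∃ d : ℕ, D ≤ (d : ℝ) ∧ (d : ℝ) ≤ 2 * D ∧ d ^ 2 ∣ n) with hF
  have hx0 : 0 ≤ x := by linarith
  have hS : Scount b x D = F.card := by
    rw [Scount, ← Set.ncard_coe_finset]
    congr 1
    ext n
    simp only [hF, Finset.coe_filter, Finset.mem_Icc, Set.mem_ofPred_eq]
    refine ⟨fun hn => ⟨⟨hn.1.1, Nat.le_floor hn.1.2.1⟩, hn⟩, fun hn => hn.2⟩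
  set m := Nat.log b ⌊x⌋₊ with hm
  have hfl : 1 ≤ ⌊x⌋₊ := (Nat.one_le_floor_iff x).2 hx
  have hbm : (b : ℝ) ^ m ≤ x := by
    have : b ^ m ≤ ⌊x⌋₊ := Nat.pow_log_le_self b (by omega)
    exact (by exact_mod_cast this : (b : ℝ) ^ m ≤ (⌊x⌋₊ : ℝ)).trans (Nat.floor_le hx0)
  have hbR : (2 : ℝ) ≤ b := by exact_mod_cast hb
  have hm2 : (m : ℝ) ≤ 2 * Real.log x := by
    have h2 : (2 : ℝ) ^ m ≤ x := (pow_le_pow_left₀ (by norm_num) hbR m).trans hbm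
    have h3 := Real.log_le_log (by positivity) h2
    rw [Real.log_pow] at h3
    have := Real.log_two_gt_d9
    have hm0 : (0 : ℝ) ≤ m := Nat.cast_nonneg m
    nlinarith
  have hlen : ∀ n ∈ F, (Nat.digits b n).length ∈ Finset.Icc 1 (m + 1) := by
    intro n hn
    simp only [hF, Finset.mem_filter, Finset.mem_Icc] at hn ⊢
    rw [Nat.length_digits b n hb (by omega)]
    exact ⟨by omega, Nat.succ_le_succ (Nat.log_mono_right hn.1.2)⟩
  have hcard := Finset.card_eq_sum_card_fiberwise hlen
  rw [hS, hcard]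
  push_cast
  have hfib : ∀ N ∈ Finset.Icc 1 (m + 1),
      ((F.filter (fun n => (Nat.digits b n).length = N)).card : ℝ) ≤ c := by
    intro N hN
    rw [Finset.mem_Icc] at hN
    refine h N _ hN.1 ((pow_le_pow_right₀ (by linarith) (by omega)).trans hbm) ?_
    intro n hn
    simp only [hF, Finset.mem_filter] at hn
    obtain ⟨⟨-, ⟨-, -, ⟨-, hpal⟩, hgcd⟩, hd⟩, hl⟩ := hn
    refine ⟨hl, hpal, ?_, hd⟩
    exact Nat.Coprime.coprime_dvd_right
      (Nat.dvd_sub (dvd_pow_self b three_ne_zero) dvd_rfl) hgcd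
  refine (Finset.sum_le_sum hfib).trans ?_
  rw [Finset.sum_const, nsmul_eq_mul, Nat.card_Icc, Nat.add_sub_cancel]
  gcongr
  push_cast
  linarith [Real.log_nonneg hx]

lemma Scount_le_self {b : ℕ} {x D : ℝ} (hx : 0 ≤ x) : (Scount b x D : ℝ) ≤ x := by
  have h : Scount b x D ≤ ⌊x⌋₊ := by
    rw [Scount]
    refine (Set.ncard_le_ncard (t := Finset.Icc 1 ⌊x⌋₊) ?_ (Finset.finite_toSet _)).trans ?_
    · intro n hn
      simp only [Finset.coe_Icc, Set.mem_Icc]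
      exact ⟨hn.1.1, Nat.le_floor hn.1.2.1⟩
    · rw [Set.ncard_coe_finset, Nat.card_Icc, Nat.add_sub_cancel]
  exact (by exact_mod_cast h : (Scount b x D : ℝ) ≤ (⌊x⌋₊ : ℝ)).trans (Nat.floor_le hx)

/-- For all `b ≥ 2` and `ε > 0`, if `x^{3/13} ≤ D ≤ x^{8/31-ε}` then
`S_b(x,D) ≪_{b,ε} x^{7/11} / D^{13/22-ε}`. -/
theorem Scount_le_AB_process (b : ℕ) (hb : 2 ≤ b) (ε : ℝ) (hε : 0 < ε) :
    ∃ C : ℝ, ∀ x D : ℝ, 1 ≤ x → x ^ ((3 : ℝ) / 13) ≤ D → D ≤ x ^ ((8 : ℝ) / 31 - ε) →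
      (Scount b x D : ℝ) ≤ C * x ^ ((7 : ℝ) / 11) / D ^ ((13 : ℝ) / 22 - ε) := by
  have hbR : (2 : ℝ) ≤ b := by exact_mod_cast hb
  obtain ⟨x₀, hx₀, hlarge⟩ := exists_forall_mul_log_sq_le_rpow (c := 10 ^ 6 * (b : ℝ) ^ 8) (by
    have : (1 : ℝ) ≤ b ^ 8 := one_le_pow₀ (by linarith)
    linarith)
  refine ⟨x₀ + 300 * b * (1 + 13 / (3 * ε)), fun x D hx hD1 hD2 => ?_⟩
  have hx0 : 0 < x := by linarith
  have hD_one : 1 ≤ D := (Real.one_le_rpow hx (by norm_num)).trans hD1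
  have hD : 0 < D := by linarith
  have hD3 : D ≤ x ^ ((8 : ℝ) / 31) :=
    hD2.trans (Real.rpow_le_rpow_of_exponent_le hx (by linarith))
  set T : ℝ := x ^ ((7 : ℝ) / 11) / D ^ ((13 : ℝ) / 22) with hT
  have hT0 : 0 < T := by positivity
  have hDT : D ≤ T := by
    refine (saving_inequalities (Z := x ^ ((1 : ℝ) / 1000)) hx hD hT0 (by positivity) ?_ ?_ ?_
      ?_).2.1
    · rw [Real.log_rpow hx0]; ring
    · rw [hT, Real.log_div (by positivity) (by positivity), Real.log_rpow hx0, Real.log_rpow hD]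
    · rw [← Real.log_rpow hx0]; exact Real.log_le_log (by positivity) hD1
    · rw [← Real.log_rpow hx0]; exact Real.log_le_log hD hD3
  have hDε : 1 ≤ D ^ ε := Real.one_le_rpow hD_one hε.le
  have hTD : 1 ≤ T * D ^ ε := one_le_mul_of_one_le_of_one_le (hD_one.trans hDT) hDε
  have e : (x₀ + 300 * b * (1 + 13 / (3 * ε))) * x ^ ((7 : ℝ) / 11) / D ^ ((13 : ℝ) / 22 - ε) =
      x₀ * (T * D ^ ε) + 300 * b * (1 + 13 / (3 * ε)) * (T * D ^ ε) := by
    rw [Real.rpow_sub hD, hT]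
    field_simp
  rw [e]
  rcases lt_or_ge x x₀ with hlt | hge
  · have h1 := Scount_le_self (b := b) (D := D) hx0.le
    have h2 : x₀ ≤ x₀ * (T * D ^ ε) := le_mul_of_one_le_right (by linarith) hTD
    have h3 : 0 ≤ 300 * b * (1 + 13 / (3 * ε)) * (T * D ^ ε) := by positivity
    linarith
  · have h1 := Scount_le_of_forall_length (D := D) (c := 100 * b * T) hb hx (by positivity)
      (fun N F hN hNx hF =>
        card_palindromes_length_le hb hN hx (hlarge x hge) hD hT hD1 hD3 hNx F hF)
    have h2 : 1 + Real.log x ≤ (1 + 13 / (3 * ε)) * D ^ ε := by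
      have h3 := Real.log_le_rpow_div hx0.le (show 0 < 3 / 13 * ε by positivity)
      have h4 : x ^ (3 / 13 * ε) ≤ D ^ ε := by
        rw [Real.rpow_mul hx0.le]
        exact Real.rpow_le_rpow (by positivity) hD1 hε.le
      have h5 : x ^ (3 / 13 * ε) / (3 / 13 * ε) ≤ 13 / (3 * ε) * D ^ ε := by
        calc x ^ (3 / 13 * ε) / (3 / 13 * ε) ≤ D ^ ε / (3 / 13 * ε) := by gcongr
          _ = _ := by field_simp
      linarith
    have h6 : 0 ≤ x₀ * (T * D ^ ε) := by positivity
    calc (Scount b x D : ℝ) ≤ 3 * (1 + Real.log x) * (100 * b * T) := h1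
      _ ≤ 3 * ((1 + 13 / (3 * ε)) * D ^ ε) * (100 * b * T) := by gcongr
      _ = 300 * b * (1 + 13 / (3 * ε)) * (T * D ^ ε) := by ring
      _ ≤ _ := by linarith
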